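/- Let u : ℝ^{1+m} → ℝ^{1+m} be smooth, divergence-free, h-periodic in every coordinate, and mean-zero over its period cell, and let f : [0,1] → ℝ be Lipschitz with f(0) = f(1) = 0 and f(T) > 0 for all T ∈ (0,1). Then there exist 0 < γ₁ < γ₂ < ∞ (independent of η) such that for every η > 0 there is L₁ = L₁(η) < ∞ with the following property: every classical solution T of T_t + u·∇T = ΔT + M f(T) whose initial datum T₀ is compactly supported in x, satisfies 0 ≤ T₀ ≤ 1, and satisfies T₀(x,y) ≥ η whenever |x| ≤ L₁, obeys lim_{t→∞} inf_{|x| ≤ γ₁ t, y ∈ ℝ^m} T(t,x,y) = 1 and lim_{t→∞} sup_{|x| ≥ γ₂ t, y ∈ ℝ^m} T(t,x,y) = 0. -/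

import Mathlib

open MeasureTheory
open scoped BigOperators

noncomputable section

/-- Partial derivative of `g : ℝ^N → ℝ` in the `i`-th coordinate direction. -/
def pd {N : ℕ} (i : Fin N) (g : (Fin N → ℝ) → ℝ) (z : Fin N → ℝ) : ℝ :=
  fderiv ℝ g z (Pi.single i 1)

/-- Laplacian of `g : ℝ^N → ℝ`. -/
def lap {N : ℕ} (g : (Fin N → ℝ) → ℝ) (z : Fin N → ℝ) : ℝ :=
  ∑ i, pd i (pd i g) z

/-- A classical solution of `T_t + u·∇T = ΔT + M f(T)` on the cylinder `ℝ×[0,h]^m`,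
viewed as a `[0,1]`-valued function on `ℝ^{1+m}` (coordinate `0` is `x`, the remaining `m`
coordinates are `y`), `h`-periodic in each of the last `m` spatial coordinates,
continuous on `[0,∞)×ℝ^{1+m}`, `C¹` in `t` and `C²` in the spatial variables for `t > 0`,
satisfying the equation pointwise for `t > 0` and `T(0,·) = T₀`. -/
structure IsCylSol (m : ℕ) (h M : ℝ) (u : (Fin (m+1) → ℝ) → Fin (m+1) → ℝ)
    (f : ℝ → ℝ) (T0 : (Fin (m+1) → ℝ) → ℝ) (T : ℝ → (Fin (m+1) → ℝ) → ℝ) : Prop where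
  cont : ContinuousOn (fun p : ℝ × (Fin (m+1) → ℝ) => T p.1 p.2) {p | 0 ≤ p.1}
  mem_Icc : ∀ t z, 0 ≤ t → T t z ∈ Set.Icc (0:ℝ) 1
  periodic : ∀ t z, 0 ≤ t → ∀ j : Fin m, T t (z + Pi.single j.succ h) = T t z
  timeDiff : ∀ t z, 0 < t → DifferentiableAt ℝ (fun s => T s z) t
  spaceC2 : ∀ t, 0 < t → ContDiff ℝ 2 (T t)
  eqn : ∀ t z, 0 < t →
    deriv (fun s => T s z) t + ∑ i, u z i * pd i (T t) z
      = lap (T t) z + M * f (T t z)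
  init : ∀ z, T 0 z = T0 z

section

open Filter Topology Set

/-- A function invariant under coordinate translations is invariant under their integer
combinations. -/
lemma eq_add_sum_zsmul_of_periodic {N : ℕ} {α : Type*} {h : ℝ} {F : (Fin N → ℝ) → α}
    (S : Finset (Fin N)) (hF : ∀ z, ∀ j ∈ S, F (z + Pi.single j h) = F z)
    (n : Fin N → ℤ) (z : Fin N → ℝ) :
    F (z + ∑ j ∈ S, Pi.single j (n j * h)) = F z := by
  induction S using Finset.induction_on generalizing z with
  | empty => simp
  | insert j S hj ih =>
    have hP : Function.Periodic F (Pi.single j h) := fun z => hF z j (Finset.mem_insert_self _ _)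
    have e : (Pi.single j (n j * h) : Fin N → ℝ) = n j • Pi.single j h := by
      rw [← Pi.single_smul]; simp
    rw [Finset.sum_insert hj, ← add_assoc,
      ih (fun z k hk => hF z k (Finset.mem_insert_of_mem hk)), e]
    exact hP.zsmul _ _

/-- Translate a point by periods so that the coordinates in `S` land in `[0, h)`. -/
lemma exists_periodic_rep {N : ℕ} {h : ℝ} (hh : 0 < h) (S : Finset (Fin N)) (z : Fin N → ℝ) :
    ∃ n : Fin N → ℤ, (∀ j ∈ S, (z + ∑ j ∈ S, Pi.single j (n j * h) : Fin N → ℝ) j ∈ Ico 0 h) ∧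
      ∀ j ∉ S, (z + ∑ j ∈ S, Pi.single j (n j * h) : Fin N → ℝ) j = z j := by
  refine ⟨fun j => -toIcoDiv hh 0 (z j), fun j hj => ?_, fun j hj => ?_⟩
  · have := sub_toIcoDiv_zsmul_mem_Ico hh 0 (z j)
    simp only [Pi.add_apply, Finset.sum_apply, Pi.single_apply]
    rw [Finset.sum_ite_eq, if_pos hj]
    simpa [sub_eq_add_neg] using this
  · simp [Finset.sum_apply, Pi.single_apply, hj]

lemma exists_bound_of_periodic {N : ℕ} {h : ℝ} (hh : 0 < h) {E : Type*} [NormedAddCommGroup E]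
    {F : (Fin N → ℝ) → E} (hc : Continuous F) (hF : ∀ z j, F (z + Pi.single j h) = F z) :
    ∃ C, 0 ≤ C ∧ ∀ z, ‖F z‖ ≤ C := by
  have hK : IsCompact (Set.pi univ fun _ : Fin N => Icc (0:ℝ) h) :=
    isCompact_univ_pi fun _ => isCompact_Icc
  obtain ⟨C, hC⟩ := hK.exists_bound_of_continuousOn hc.continuousOn
  refine ⟨max C 0, le_max_right _ _, fun z => ?_⟩
  obtain ⟨n, hn, -⟩ := exists_periodic_rep hh Finset.univ z
  rw [← eq_add_sum_zsmul_of_periodic Finset.univ (fun z j _ => hF z j) n z]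
  exact (hC _ fun j _ => Ico_subset_Icc_self (hn j (Finset.mem_univ j))).trans (le_max_left _ _)

lemma pd_eq_zero_of_isLocalMax {N : ℕ} {g : (Fin N → ℝ) → ℝ} {z : Fin N → ℝ}
    (hm : IsLocalMax g z) (i : Fin N) : pd i g z = 0 := by
  simp [pd, hm.fderiv_eq_zero]

lemma pd_pd_nonpos_of_isLocalMax {N : ℕ} {g : (Fin N → ℝ) → ℝ} {z : Fin N → ℝ}
    (hg : ContDiffAt ℝ 2 g z) (hm : IsLocalMax g z) (i : Fin N) : pd i (pd i g) z ≤ 0 := by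
  set e : Fin N → ℝ := Pi.single i 1 with he
  have hline (s : ℝ) : HasDerivAt (fun s : ℝ => z + s • e) e s := by
    simpa using ((hasDerivAt_id s).smul_const e).const_add z
  have hz : z + (0:ℝ) • e = z := by simp
  have ht : Tendsto (fun s : ℝ => z + s • e) (𝓝 0) (𝓝 z) := by
    simpa using (hline 0).continuousAt.tendsto
  have hd1 : ∀ᶠ w in 𝓝 z, DifferentiableAt ℝ g w := by
    filter_upwards [hg.eventually (by simp)] with w hw using hw.differentiableAt (by simp)
  have hφ' : deriv (fun s : ℝ => g (z + s • e)) =ᶠ[𝓝 0] fun s => pd i g (z + s • e) := by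
    filter_upwards [ht.eventually hd1] with s hs
    exact (hs.hasFDerivAt.comp_hasDerivAt s (hline s)).deriv
  have hpd : DifferentiableAt ℝ (pd i g) z := by
    have : ContDiffAt ℝ 1 (fderiv ℝ g) z := hg.fderiv_right (by norm_num)
    exact (this.differentiableAt (by simp)).clm_apply (differentiableAt_const _)
  have hφ'' : deriv (deriv fun s : ℝ => g (z + s • e)) 0 = pd i (pd i g) z := by
    rw [hφ'.deriv_eq]
    have h2 : HasFDerivAt (pd i g) (fderiv ℝ (pd i g) z) (z + (0:ℝ) • e) := by
      rw [hz]; exact hpd.hasFDerivAt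
    exact (h2.comp_hasDerivAt (0:ℝ) (hline 0)).deriv
  have hmax : IsLocalMax (fun s : ℝ => g (z + s • e)) 0 := by
    filter_upwards [ht.eventually hm] with s hs
    simpa using hs
  by_contra! hpos
  have hmin := isLocalMin_of_deriv_deriv_pos (f := fun s : ℝ => g (z + s • e)) (x₀ := 0)
    (by rw [hφ'']; exact hpos) hmax.deriv_eq_zero
    (by
      have h2 : HasFDerivAt g (fderiv ℝ g z) (z + (0:ℝ) • e) := by
        rw [hz]; exact (hg.differentiableAt (by simp)).hasFDerivAt
      exact (h2.comp_hasDerivAt (0:ℝ) (hline 0)).continuousAt)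
  have hconst : (fun s : ℝ => g (z + s • e)) =ᶠ[𝓝 0] fun _ => g (z + (0:ℝ) • e) := by
    filter_upwards [hmin, hmax] with s h1 h2 using le_antisymm h2 h1
  have : deriv (deriv fun s : ℝ => g (z + s • e)) 0 = 0 := by
    rw [hconst.deriv.deriv_eq]; simp
  rw [hφ''] at this
  exact hpos.ne' this

lemma lap_nonpos_of_isLocalMax {N : ℕ} {g : (Fin N → ℝ) → ℝ} {z : Fin N → ℝ}
    (hg : ContDiffAt ℝ 2 g z) (hm : IsLocalMax g z) : lap g z ≤ 0 :=
  Finset.sum_nonpos fun i _ => pd_pd_nonpos_of_isLocalMax hg hm i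

/-- Parabolic maximum principle on the cylinder: the differential inequality is only needed where
`W` is positive, and there `x` is assumed to be bounded. -/
theorem cylinder_max_principle {m : ℕ} {h K R t₀ t₁ : ℝ} (hh : 0 < h)
    (u : (Fin (m + 1) → ℝ) → Fin (m + 1) → ℝ) (W : ℝ → (Fin (m + 1) → ℝ) → ℝ)
    (hc : ContinuousOn (fun p : ℝ × (Fin (m + 1) → ℝ) => W p.1 p.2) {p | t₀ ≤ p.1})
    (hper : ∀ t z, t₀ ≤ t → ∀ j : Fin m, W t (z + Pi.single j.succ h) = W t z)
    (hR : ∀ t z, t₀ ≤ t → t ≤ t₁ → 0 < W t z → |z 0| ≤ R)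
    (h0 : ∀ z, W t₀ z ≤ 0)
    (hd : ∀ t z, t₀ < t → t ≤ t₁ → 0 < W t z →
      ∃ a, HasDerivAt (fun s => W s z) a t ∧ ContDiffAt ℝ 2 (W t) z ∧
        a + ∑ i, u z i * pd i (W t) z ≤ lap (W t) z + K * W t z) :
    ∀ t z, t₀ ≤ t → t ≤ t₁ → W t z ≤ 0 := by
  intro t₂ z₂ ht₂ ht₂'
  by_contra! hpos
  have hrep (z : Fin (m + 1) → ℝ) : ∃ z' : Fin (m + 1) → ℝ, z' 0 = z 0 ∧
      (∀ j : Fin m, z' j.succ ∈ Icc 0 h) ∧ ∀ t, t₀ ≤ t → W t z' = W t z := by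
    obtain ⟨n, hn, hn'⟩ := exists_periodic_rep hh (Finset.univ.erase 0) z
    refine ⟨_, hn' 0 (by simp), fun j => Ico_subset_Icc_self (hn j.succ (by simp)), fun t ht =>
      eq_add_sum_zsmul_of_periodic _ (fun z j hj => ?_) n z⟩
    obtain ⟨i, rfl⟩ := Fin.exists_succ_eq.2 (Finset.ne_of_mem_erase hj)
    exact hper t z ht i
  set box : Set (Fin (m + 1) → ℝ) :=
    Set.pi univ (Fin.cons (Icc (-R) R) fun _ => Icc 0 h) with hbox
  have hmem {z : Fin (m + 1) → ℝ} (h1 : |z 0| ≤ R) (h2 : ∀ j : Fin m, z j.succ ∈ Icc 0 h) :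
      z ∈ box := by
    intro j _
    refine Fin.cases ?_ (fun j => ?_) j
    · simpa [abs_le] using h1
    · simpa using h2 j
  have hboxc : IsCompact box := by
    refine isCompact_univ_pi fun j => ?_
    refine Fin.cases ?_ (fun j => ?_) j
    · simpa using isCompact_Icc
    · simpa using isCompact_Icc
  set K' := K + 1
  set F : ℝ × (Fin (m + 1) → ℝ) → ℝ := fun p => Real.exp (-K' * p.1) * W p.1 p.2 with hF
  have hFc : ContinuousOn F (Icc t₀ t₁ ×ˢ box) :=
    ContinuousOn.mul (by fun_prop) (hc.mono fun p hp => hp.1.1)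
  obtain ⟨z₂', hz0, hzj, hzW⟩ := hrep z₂
  have hmem₂ : (t₂, z₂') ∈ Icc t₀ t₁ ×ˢ box :=
    ⟨⟨ht₂, ht₂'⟩, hmem (show |z₂' 0| ≤ R by rw [hz0]; exact hR _ _ ht₂ ht₂' hpos) hzj⟩
  obtain ⟨⟨t, z⟩, ⟨⟨htl, htu⟩, hzb⟩, hmax⟩ :=
    (isCompact_Icc.prod hboxc).exists_isMaxOn ⟨_, hmem₂⟩ hFc
  have hWpos : 0 < W t z := by
    have h1 : F (t₂, z₂') ≤ F (t, z) := hmax hmem₂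
    have h2 : 0 < F (t₂, z₂') := by
      simp only [hF, hzW t₂ ht₂]; positivity
    exact (mul_pos_iff_of_pos_left (Real.exp_pos _)).1 (h2.trans_le h1)
  simp only at htl htu hzb
  have htl' : t₀ < t := by
    rcases htl.eq_or_lt with e | e
    · subst e; exact absurd (h0 z) (not_le.2 hWpos)
    · exact e
  have hglob : ∀ w, W t w ≤ W t z := by
    intro w
    by_contra! hw
    obtain ⟨w', hw0, hwj, hwW⟩ := hrep w
    have h1 : F (t, w') ≤ F (t, z) :=
      hmax ⟨⟨htl, htu⟩, hmem (show |w' 0| ≤ R by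
      rw [hw0]; exact hR _ _ htl htu (hWpos.trans hw)) hwj⟩
    simp only [hF, hwW t htl] at h1
    exact absurd (le_of_mul_le_mul_left h1 (Real.exp_pos _)) (not_le.2 hw)
  have hloc : IsLocalMax (W t) z := Eventually.of_forall hglob
  obtain ⟨a, ha, hC2, hineq⟩ := hd t z htl' htu hWpos
  have hlap := lap_nonpos_of_isLocalMax hC2 hloc
  simp only [pd_eq_zero_of_isLocalMax hloc, mul_zero, Finset.sum_const_zero, add_zero] at hineq
  have hder : HasDerivAt (fun s => F (s, z))
      (Real.exp (-K' * t) * (-K') * W t z + Real.exp (-K' * t) * a) t := by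
    have h1 : HasDerivAt (fun s => Real.exp (-K' * s)) (Real.exp (-K' * t) * (-K')) t := by
      simpa using ((hasDerivAt_id t).const_mul (-K')).exp
    exact h1.mul ha
  have hneg : Real.exp (-K' * t) * (-K') * W t z + Real.exp (-K' * t) * a < 0 := by
    have : a - K' * W t z < 0 := by simp only [K']; linarith
    nlinarith [Real.exp_pos (-K' * t)]
  have hslope := (hasDerivAt_iff_tendsto_slope.1 hder).eventually_lt_const hneg
  have hev : ∀ᶠ s in 𝓝[<] t, slope (fun s => F (s, z)) t s < 0 :=
    hslope.filter_mono (nhdsWithin_mono _ fun s hs => ne_of_lt hs)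
  obtain ⟨s, hs1, hs2, hs3⟩ := (hev.and (Ioo_mem_nhdsLT htl')).exists
  have h1 : F (s, z) ≤ F (t, z) := hmax ⟨⟨hs2.le, hs3.le.trans htu⟩, hzb⟩
  rw [slope_def_field, div_neg_iff] at hs1
  rcases hs1 with h | h <;> linarith [h.1, h.2]

lemma pd_sub {N : ℕ} {g₁ g₂ : (Fin N → ℝ) → ℝ} {z : Fin N → ℝ} (i : Fin N)
    (h₁ : DifferentiableAt ℝ g₁ z) (h₂ : DifferentiableAt ℝ g₂ z) :
    pd i (fun w => g₁ w - g₂ w) z = pd i g₁ z - pd i g₂ z := by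
  simp [pd, fderiv_fun_sub h₁ h₂]

lemma ContDiffAt.eventually_differentiableAt {N : ℕ} {g : (Fin N → ℝ) → ℝ} {z : Fin N → ℝ}
    (hg : ContDiffAt ℝ 2 g z) : ∀ᶠ w in 𝓝 z, DifferentiableAt ℝ g w := by
  filter_upwards [hg.eventually (by simp)] with w hw using hw.differentiableAt (by simp)

lemma ContDiffAt.differentiableAt_pd {N : ℕ} {g : (Fin N → ℝ) → ℝ} {z : Fin N → ℝ}
    (hg : ContDiffAt ℝ 2 g z) (i : Fin N) : DifferentiableAt ℝ (pd i g) z := by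
  have : ContDiffAt ℝ 1 (fderiv ℝ g) z := hg.fderiv_right (by norm_num)
  exact (this.differentiableAt (by simp)).clm_apply (differentiableAt_const _)

lemma pd_congr {N : ℕ} {g₁ g₂ : (Fin N → ℝ) → ℝ} {z : Fin N → ℝ} (i : Fin N)
    (h : g₁ =ᶠ[𝓝 z] g₂) : pd i g₁ z = pd i g₂ z := by
  simp [pd, h.fderiv_eq]

lemma lap_congr {N : ℕ} {g₁ g₂ : (Fin N → ℝ) → ℝ} {z : Fin N → ℝ}
    (h : g₁ =ᶠ[𝓝 z] g₂) : lap g₁ z = lap g₂ z :=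
  Finset.sum_congr rfl fun i _ => pd_congr i <| by
    filter_upwards [h.eventually_nhds] with w hw using pd_congr i hw

lemma lap_sub {N : ℕ} {g₁ g₂ : (Fin N → ℝ) → ℝ} {z : Fin N → ℝ}
    (h₁ : ContDiffAt ℝ 2 g₁ z) (h₂ : ContDiffAt ℝ 2 g₂ z) :
    lap (fun w => g₁ w - g₂ w) z = lap g₁ z - lap g₂ z := by
  rw [lap, lap, lap, ← Finset.sum_sub_distrib]
  refine Finset.sum_congr rfl fun i _ => ?_
  rw [← pd_sub i (h₁.differentiableAt_pd i) (h₂.differentiableAt_pd i)]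
  apply pd_congr
  filter_upwards [h₁.eventually_differentiableAt, h₂.eventually_differentiableAt] with w hw₁ hw₂
    using pd_sub i hw₁ hw₂

lemma pd_comp {N : ℕ} {Φ : ℝ → ℝ} {b : ℝ} {q : (Fin N → ℝ) → ℝ} {z : Fin N → ℝ} (i : Fin N)
    (hΦ : HasDerivAt Φ b (q z)) (hq : DifferentiableAt ℝ q z) :
    pd i (fun w => Φ (q w)) z = b * pd i q z := by
  have := (hΦ.comp_hasFDerivAt z hq.hasFDerivAt).fderiv
  simp only [pd]
  erw [this]
  simp

lemma pd_mul {N : ℕ} {g₁ g₂ : (Fin N → ℝ) → ℝ} {z : Fin N → ℝ} (i : Fin N)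
    (h₁ : DifferentiableAt ℝ g₁ z) (h₂ : DifferentiableAt ℝ g₂ z) :
    pd i (fun w => g₁ w * g₂ w) z = g₁ z * pd i g₂ z + pd i g₁ z * g₂ z := by
  simp [pd, fderiv_fun_mul h₁ h₂, mul_comm]

lemma lap_comp {N : ℕ} {Φ Φ' Φ'' : ℝ → ℝ} {q : (Fin N → ℝ) → ℝ}
    (hΦ : ∀ s, HasDerivAt Φ (Φ' s) s) (hΦ' : ∀ s, HasDerivAt Φ' (Φ'' s) s)
    (hq : ContDiff ℝ 2 q) (z : Fin N → ℝ) :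
    lap (fun w => Φ (q w)) z
      = Φ'' (q z) * ∑ i, pd i q z ^ 2 + Φ' (q z) * lap q z := by
  have hd : Differentiable ℝ q := hq.differentiable (by simp)
  rw [lap, lap, Finset.mul_sum, Finset.mul_sum, ← Finset.sum_add_distrib]
  refine Finset.sum_congr rfl fun i _ => ?_
  rw [show pd i (fun w => Φ (q w)) = fun w => Φ' (q w) * pd i q w from
      funext fun w => pd_comp i (hΦ _) (hd w),
    pd_mul (g₁ := fun w => Φ' (q w)) i ((hΦ' _).differentiableAt.comp z (hd z)) (hq.contDiffAt.differentiableAt_pd i),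
    pd_comp i (hΦ' _) (hd z)]
  ring

lemma pd_eval {N : ℕ} (i j : Fin N) (z : Fin N → ℝ) :
    pd i (fun w => w j) z = if i = j then 1 else 0 := by
  have : fderiv ℝ (fun w : Fin N → ℝ => w j) z = ContinuousLinearMap.proj j :=
    (ContinuousLinearMap.proj (R := ℝ) (φ := fun _ : Fin N => ℝ) j).fderiv
  simp [pd, this, Pi.single_apply, eq_comm]

lemma lap_eval {N : ℕ} (j : Fin N) (z : Fin N → ℝ) : lap (fun w => w j) z = 0 := by
  refine Finset.sum_eq_zero fun i _ => ?_
  rw [show pd i (fun w : Fin N → ℝ => w j) = fun _ => if i = j then 1 else 0 from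
    funext fun w => pd_eval i j w]
  simp [pd]

/-- Drift and Laplacian of a function of the first coordinate alone. -/
lemma drift_lap_comp_eval {m : ℕ} {Φ Φ' Φ'' : ℝ → ℝ} (hΦ : ∀ s, HasDerivAt Φ (Φ' s) s)
    (hΦ' : ∀ s, HasDerivAt Φ' (Φ'' s) s) (v z : Fin (m + 1) → ℝ) :
    ∑ i, v i * pd i (fun w => Φ (w 0)) z = v 0 * Φ' (z 0) ∧
      lap (fun w : Fin (m + 1) → ℝ => Φ (w 0)) z = Φ'' (z 0) := by
  have hd : Differentiable ℝ fun w : Fin (m + 1) → ℝ => w 0 := differentiable_apply 0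
  constructor
  · simp_rw [fun i => pd_comp i (hΦ (z 0)) (hd z), pd_eval]
    simp
  · rw [lap_comp hΦ hΦ' (contDiff_apply ℝ ℝ 0)]
    simp [pd_eval, lap_eval]

section Comparison

variable {m : ℕ} {h M : ℝ} {u : (Fin (m + 1) → ℝ) → Fin (m + 1) → ℝ} {f : ℝ → ℝ}
  {T0 : (Fin (m + 1) → ℝ) → ℝ} {T : ℝ → (Fin (m + 1) → ℝ) → ℝ}

/-- Comparison with subsolutions. -/
theorem IsCylSol.subsolution_le (hT : IsCylSol m h M u f T0 T) (hh : 0 < h) (hM : 0 < M)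
    {K : NNReal} (hf : LipschitzOnWith K f (Icc 0 1)) {t₀ t₁ R : ℝ} (ht₀ : 0 ≤ t₀)
    {φ : ℝ → (Fin (m + 1) → ℝ) → ℝ}
    (hc : ContinuousOn (fun p : ℝ × (Fin (m + 1) → ℝ) => φ p.1 p.2) {p | t₀ ≤ p.1})
    (hper : ∀ t z, t₀ ≤ t → ∀ j : Fin m, φ t (z + Pi.single j.succ h) = φ t z)
    (hR : ∀ t z, t₀ ≤ t → t ≤ t₁ → T t z < φ t z → |z 0| ≤ R)
    (h0 : ∀ z, φ t₀ z ≤ T t₀ z)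
    (hφ : ∀ t z, t₀ < t → t ≤ t₁ → T t z < φ t z → φ t z ≤ 1 ∧
      ∃ a, HasDerivAt (fun s => φ s z) a t ∧ ContDiffAt ℝ 2 (φ t) z ∧
        a + ∑ i, u z i * pd i (φ t) z ≤ lap (φ t) z + M * f (φ t z)) :
    ∀ t z, t₀ ≤ t → t ≤ t₁ → φ t z ≤ T t z := by
  have := cylinder_max_principle (K := M * K) (R := R) (t₀ := t₀) (t₁ := t₁) hh u
    (fun t z => φ t z - T t z)
    (hc.sub (hT.cont.mono fun p (hp : t₀ ≤ p.1) => ht₀.trans hp))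
    (fun t z ht j => by rw [hper t z ht, hT.periodic t z (ht₀.trans ht)])
    (fun t z h1 h2 h3 => hR t z h1 h2 (sub_pos.1 h3)) (fun z => sub_nonpos.2 (h0 z)) ?_
  · exact fun t z h1 h2 => sub_nonpos.1 (this t z h1 h2)
  intro t z h1 h2 h3
  have h3' := sub_pos.1 h3
  have ht := ht₀.trans_lt h1
  obtain ⟨hle, a, ha, hC, hin⟩ := hφ t z h1 h2 h3'
  have hTC : ContDiffAt ℝ 2 (T t) z := (hT.spaceC2 t ht).contDiffAt
  have hTm := hT.mem_Icc t z ht.le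
  refine ⟨_, ha.sub (hT.timeDiff t z ht).hasDerivAt, hC.sub hTC, ?_⟩
  have hL := hf.dist_le_mul (φ t z) ⟨hTm.1.trans h3'.le, hle⟩ (T t z) hTm
  rw [Real.dist_eq, Real.dist_eq, abs_of_pos h3] at hL
  have hL' := mul_le_mul_of_nonneg_left ((le_abs_self _).trans hL) hM.le
  have heq := hT.eqn t z ht
  rw [lap_sub hC hTC]
  simp_rw [pd_sub _ (hC.differentiableAt (by simp)) (hTC.differentiableAt (by simp)), mul_sub,
    Finset.sum_sub_distrib]
  nlinarith

/-- Comparison with supersolutions of the linearized equation. -/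
theorem IsCylSol.le_supersolution (hT : IsCylSol m h M u f T0 T) (hh : 0 < h) (hM : 0 < M)
    {K : NNReal} (hf : LipschitzOnWith K f (Icc 0 1)) (hf0 : f 0 = 0) {t₁ R : ℝ}
    {φ : ℝ → (Fin (m + 1) → ℝ) → ℝ}
    (hc : ContinuousOn (fun p : ℝ × (Fin (m + 1) → ℝ) => φ p.1 p.2) {p | 0 ≤ p.1})
    (hper : ∀ t z, 0 ≤ t → ∀ j : Fin m, φ t (z + Pi.single j.succ h) = φ t z)
    (hR : ∀ t z, 0 ≤ t → t ≤ t₁ → φ t z < T t z → |z 0| ≤ R)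
    (h0 : ∀ z, T 0 z ≤ φ 0 z)
    (hφ : ∀ t z, 0 < t → t ≤ t₁ → φ t z < T t z →
      ∃ a, HasDerivAt (fun s => φ s z) a t ∧ ContDiffAt ℝ 2 (φ t) z ∧
        lap (φ t) z + M * (K * φ t z) ≤ a + ∑ i, u z i * pd i (φ t) z) :
    ∀ t z, 0 ≤ t → t ≤ t₁ → T t z ≤ φ t z := by
  have := cylinder_max_principle (K := M * K) (R := R) (t₀ := 0) (t₁ := t₁) hh u
    (fun t z => T t z - φ t z) (hT.cont.sub hc)
    (fun t z ht j => by rw [hper t z ht, hT.periodic t z ht])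
    (fun t z h1 h2 h3 => hR t z h1 h2 (sub_pos.1 h3)) (fun z => sub_nonpos.2 (h0 z)) ?_
  · exact fun t z h1 h2 => sub_nonpos.1 (this t z h1 h2)
  intro t z ht h2 h3
  obtain ⟨a, ha, hC, hin⟩ := hφ t z ht h2 (sub_pos.1 h3)
  have hTC : ContDiffAt ℝ 2 (T t) z := (hT.spaceC2 t ht).contDiffAt
  have hTm := hT.mem_Icc t z ht.le
  refine ⟨_, (hT.timeDiff t z ht).hasDerivAt.sub ha, hTC.sub hC, ?_⟩
  have hL := hf.dist_le_mul (T t z) hTm 0 (by simp)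
  rw [Real.dist_eq, Real.dist_eq, hf0, sub_zero, sub_zero, abs_of_nonneg hTm.1] at hL
  have hL' := mul_le_mul_of_nonneg_left ((le_abs_self _).trans hL) hM.le
  have heq := hT.eqn t z ht
  rw [lap_sub hTC hC]
  simp_rw [pd_sub _ (hTC.differentiableAt (by simp)) (hC.differentiableAt (by simp)), mul_sub,
    Finset.sum_sub_distrib]
  nlinarith

lemma abs_le_two_mul_cosh (x : ℝ) : |x| ≤ 2 * Real.cosh x := by
  have h1 := Real.add_one_le_exp |x|
  have h2 := Real.exp_abs_le x
  rw [Real.cosh_eq]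
  linarith

lemma abs_sinh_le_cosh (x : ℝ) : |Real.sinh x| ≤ Real.cosh x := by
  rw [Real.sinh_eq, Real.cosh_eq, abs_le]
  constructor <;> linarith [Real.exp_pos x, Real.exp_pos (-x)]

/-- Comparison with the localized subsolutions `s₀ + σ (t - t₀) - B cosh (x - x₀) e^{C (t - t₀)}`. -/
theorem IsCylSol.cosh_subsolution_le (hT : IsCylSol m h M u f T0 T) (hh : 0 < h) (hM : 0 < M)
    {K : NNReal} (hf : LipschitzOnWith K f (Icc 0 1)) {C : ℝ} (hC : ∀ z, 1 + |u z 0| ≤ C)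
    {t₀ t₁ x₀ s₀ σ B : ℝ} (ht₀ : 0 ≤ t₀) (hB : 0 < B) (hσ : 0 ≤ σ)
    (h0 : ∀ z, s₀ - B * Real.cosh (z 0 - x₀) ≤ T t₀ z)
    (hφ : ∀ t z, t₀ < t → t ≤ t₁ →
      T t z < s₀ + σ * (t - t₀) - B * Real.cosh (z 0 - x₀) * Real.exp (C * (t - t₀)) →
      s₀ + σ * (t - t₀) - B * Real.cosh (z 0 - x₀) * Real.exp (C * (t - t₀)) ≤ 1 ∧
      σ ≤ M * f (s₀ + σ * (t - t₀) - B * Real.cosh (z 0 - x₀) * Real.exp (C * (t - t₀)))) :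
    ∀ t z, t₀ ≤ t → t ≤ t₁ →
      s₀ + σ * (t - t₀) - B * Real.cosh (z 0 - x₀) * Real.exp (C * (t - t₀)) ≤ T t z := by
  have hC0 : 1 ≤ C := by linarith [hC 0, abs_nonneg (u 0 0)]
  refine hT.subsolution_le hh hM hf (R := |x₀| + 2 * ((s₀ + σ * (t₁ - t₀)) / B)) ht₀ (φ := fun t z =>
    s₀ + σ * (t - t₀) - B * Real.cosh (z 0 - x₀) * Real.exp (C * (t - t₀))) ?_ ?_ ?_ ?_ ?_
  · fun_prop
  · intro t z _ j
    simp
  · intro t z h1 h2 h3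
    have hT0 := (hT.mem_Icc t z (ht₀.trans h1)).1
    have he : 1 ≤ Real.exp (C * (t - t₀)) :=
      Real.one_le_exp (mul_nonneg (by linarith) (by linarith))
    have hcp : 0 < B * Real.cosh (z 0 - x₀) := mul_pos hB (Real.cosh_pos _)
    have hle : B * Real.cosh (z 0 - x₀) ≤ s₀ + σ * (t₁ - t₀) := by
      nlinarith [mul_le_mul_of_nonneg_left h2 hσ]
    have h4 : Real.cosh (z 0 - x₀) ≤ (s₀ + σ * (t₁ - t₀)) / B := by
      rw [le_div_iff₀ hB]; linarith
    have h5 := abs_le_two_mul_cosh (z 0 - x₀)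
    have h6 := abs_add_le (z 0 - x₀) x₀
    rw [sub_add_cancel] at h6
    linarith
  · intro z
    simpa using h0 z
  · intro t z h1 h2 h3
    obtain ⟨hle, hin⟩ := hφ t z h1 h2 h3
    refine ⟨hle, σ - B * Real.cosh (z 0 - x₀) * (Real.exp (C * (t - t₀)) * C), ?_, ?_, ?_⟩
    · have e1 : HasDerivAt (fun s => s - t₀) 1 t := (hasDerivAt_id t).sub_const t₀
      have e2 : HasDerivAt (fun s => s₀ + σ * (s - t₀)) σ t := by
        simpa using (e1.const_mul σ).const_add s₀
      have e3 : HasDerivAt (fun s => Real.exp (C * (s - t₀))) (Real.exp (C * (t - t₀)) * C) t := by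
        simpa using (e1.const_mul C).exp
      exact e2.sub (e3.const_mul _)
    · have : ContDiff ℝ 2 fun w : Fin (m + 1) → ℝ =>
          s₀ + σ * (t - t₀) - B * Real.cosh (w 0 - x₀) * Real.exp (C * (t - t₀)) := by fun_prop
      exact this.contDiffAt
    · set E := Real.exp (C * (t - t₀)) with hE
      have hE0 : 0 < E := Real.exp_pos _
      have d1 (s : ℝ) : HasDerivAt (fun s => s₀ + σ * (t - t₀) - B * Real.cosh (s - x₀) * E)
          (-(B * Real.sinh (s - x₀) * E)) s := by
        have := ((((hasDerivAt_id s).sub_const x₀).cosh.const_mul B).mul_const E).const_sub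
          (s₀ + σ * (t - t₀))
        simpa using this
      have d2 (s : ℝ) : HasDerivAt (fun s => -(B * Real.sinh (s - x₀) * E))
          (-(B * Real.cosh (s - x₀) * E)) s := by
        have := ((((hasDerivAt_id s).sub_const x₀).sinh.const_mul B).mul_const E).fun_neg
        simpa using this
      obtain ⟨e1, e2⟩ := drift_lap_comp_eval d1 d2 (u z) z
      rw [e1, e2]
      have hs : -(u z 0 * Real.sinh (z 0 - x₀)) ≤ |u z 0| * Real.cosh (z 0 - x₀) := by
        calc _ ≤ |u z 0 * Real.sinh (z 0 - x₀)| := neg_le_abs _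
          _ ≤ _ := by
            rw [abs_mul]; exact mul_le_mul_of_nonneg_left (abs_sinh_le_cosh _) (abs_nonneg _)
      have hs2 : (1 + |u z 0|) * Real.cosh (z 0 - x₀) ≤ C * Real.cosh (z 0 - x₀) :=
        mul_le_mul_of_nonneg_right (hC z) (Real.cosh_pos _).le
      have hs3 : 0 ≤ B * E * (C * Real.cosh (z 0 - x₀) - Real.cosh (z 0 - x₀)
          + u z 0 * Real.sinh (z 0 - x₀)) := mul_nonneg (by positivity) (by linarith)
      nlinarith

end Comparison

section Spreading

variable {m : ℕ} {h M : ℝ} {u : (Fin (m + 1) → ℝ) → Fin (m + 1) → ℝ} {f : ℝ → ℝ}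
  {T0 : (Fin (m + 1) → ℝ) → ℝ} {T : ℝ → (Fin (m + 1) → ℝ) → ℝ}

lemma exists_pos_le_of_Icc_subset {f : ℝ → ℝ} (hfc : ContinuousOn f (Icc 0 1))
    (hf_pos : ∀ s ∈ Ioo (0:ℝ) 1, 0 < f s) {a b : ℝ} (ha : 0 < a) (hab : a ≤ b) (hb : b < 1) :
    ∃ κ, 0 < κ ∧ ∀ s ∈ Icc a b, κ ≤ f s := by
  obtain ⟨s, hs, hmin⟩ := isCompact_Icc.exists_isMinOn (nonempty_Icc.2 hab)
    (hfc.mono (Icc_subset_Icc ha.le hb.le))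
  exact ⟨f s, hf_pos s ⟨ha.trans_le hs.1, hs.2.trans_lt hb⟩, fun r hr => hmin hr⟩

/-- If a solution is at least `η` on a long interval, then it is close to `1` at the centre after a
fixed time. -/
theorem exists_ignition (hh : 0 < h) (hM : 0 < M) {K : NNReal}
    (hf : LipschitzOnWith K f (Icc 0 1)) (hf0 : f 0 = 0)
    (hf_pos : ∀ s ∈ Ioo (0:ℝ) 1, 0 < f s) {C : ℝ} (hC : ∀ z, 1 + |u z 0| ≤ C)
    {η ε : ℝ} (hη : 0 < η) (hη1 : η ≤ 1 / 2) (hε : 0 < ε) (hε1 : ε ≤ 1 / 2) :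
    ∃ R τ : ℝ, 0 < R ∧ 0 < τ ∧ ∀ T0 T, IsCylSol m h M u f T0 T → ∀ t₀ x₀ : ℝ, 0 ≤ t₀ →
      (∀ z, |z 0 - x₀| ≤ R → η ≤ T t₀ z) → ∀ z, z 0 = x₀ → 1 - ε ≤ T (t₀ + τ) z := by
  have hfn : ∀ s, 0 ≤ s → s < 1 → 0 ≤ f s := fun s hs hs1 => by
    rcases hs.eq_or_lt with rfl | hs
    · exact hf0.ge
    · exact (hf_pos s ⟨hs, hs1⟩).le
  obtain ⟨κ, hκ, hfκ⟩ := exists_pos_le_of_Icc_subset hf.continuousOn hf_pos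
    (a := η / 2) (b := 1 - ε / 2) (by linarith) (by linarith) (by linarith)
  set σ := M * κ with hσ
  have hσ0 : 0 < σ := mul_pos hM hκ
  set τ := (1 - ε / 2 - η / 2) / σ with hτ
  have hτ0 : 0 < τ := div_pos (by linarith) hσ0
  have hστ : σ * τ = 1 - ε / 2 - η / 2 := by rw [hτ]; field_simp
  have hC1 : 1 ≤ C := by linarith [hC 0, abs_nonneg (u 0 0)]
  set E := Real.exp (C * τ) with hE
  have hE0 : 0 < E := Real.exp_pos _
  have hexp {t t₀ : ℝ} (ht : t ≤ t₀ + τ) : Real.exp (C * (t - t₀)) ≤ E :=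
    Real.exp_le_exp.2 (mul_le_mul_of_nonneg_left (by linarith) (by linarith))
  set R₁ := 4 * E / ε with hR₁
  have hR₁0 : 0 < R₁ := by positivity
  have hcosh₁ : 2 * E / ε ≤ Real.cosh R₁ := by
    have := (le_abs_self _).trans (abs_le_two_mul_cosh R₁)
    have e : R₁ = 2 * (2 * E / ε) := by rw [hR₁]; ring
    linarith
  set R := 4 * Real.cosh R₁ * E with hR
  have hc0 : 0 < Real.cosh R₁ := Real.cosh_pos _
  have hR0 : 0 < R := by positivity
  have hcosh : 2 * Real.cosh R₁ * E ≤ Real.cosh R := by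
    have := (le_abs_self _).trans (abs_le_two_mul_cosh R)
    linarith
  have hcR : 0 < Real.cosh R := Real.cosh_pos _
  refine ⟨R, τ, hR0, hτ0, fun T0 T hT t₀ x₀ ht₀ hinit z hz => ?_⟩
  have hlow : ∀ t z, t₀ ≤ t → t ≤ t₀ + τ → |z 0 - x₀| ≤ R₁ → η / 2 ≤ T t z := by
    intro t z h1 h2 h3
    have key := hT.cosh_subsolution_le hh hM hf hC (t₁ := t₀ + τ) (x₀ := x₀) (s₀ := η) (σ := 0)
      (B := η / Real.cosh R) ht₀ (by positivity) le_rfl ?_ ?_ t z h1 h2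
    · have h4 : Real.cosh (z 0 - x₀) ≤ Real.cosh R₁ := Real.cosh_le_cosh.2 (by
        rwa [abs_of_pos hR₁0])
      have h5 : η / Real.cosh R * Real.cosh (z 0 - x₀) * Real.exp (C * (t - t₀)) ≤
          η / Real.cosh R * Real.cosh R₁ * E := by
        gcongr
        exact hexp h2
      have h6 : η / Real.cosh R * Real.cosh R₁ * E ≤ η / 2 := by
        rw [div_mul_eq_mul_div, div_mul_eq_mul_div, div_le_div_iff₀ hcR two_pos]
        nlinarith
      linarith
    · intro w
      have hcw := Real.cosh_pos (w 0 - x₀)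
      rcases le_or_gt |w 0 - x₀| R with hw | hw
      · have : 0 ≤ η / Real.cosh R * Real.cosh (w 0 - x₀) := by positivity
        linarith [hinit w hw]
      · have h4 : Real.cosh R ≤ Real.cosh (w 0 - x₀) := Real.cosh_le_cosh.2 (by
          rw [abs_of_pos hR0]; exact hw.le)
        have : η ≤ η / Real.cosh R * Real.cosh (w 0 - x₀) := by
          rw [div_mul_eq_mul_div, le_div_iff₀ hcR]
          exact mul_le_mul_of_nonneg_left h4 hη.le
        linarith [(hT.mem_Icc t₀ w ht₀).1]
    · intro t w h1 h2 h3
      have hpos : 0 ≤ η / Real.cosh R * Real.cosh (w 0 - x₀) * Real.exp (C * (t - t₀)) := by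
        have := Real.cosh_pos (w 0 - x₀)
        positivity
      have := (hT.mem_Icc t w (ht₀.trans h1.le)).1
      exact ⟨by linarith, mul_nonneg hM.le (hfn _ (by linarith) (by linarith))⟩
  have key := hT.cosh_subsolution_le hh hM hf hC (t₁ := t₀ + τ) (x₀ := x₀) (s₀ := η / 2) (σ := σ)
    (B := 1 / Real.cosh R₁) ht₀ (by positivity) hσ0.le ?_ ?_ (t₀ + τ) z (by linarith) le_rfl
  · rw [hz, sub_self, Real.cosh_zero, add_sub_cancel_left, hστ] at key
    have : 1 / Real.cosh R₁ * 1 * E ≤ ε / 2 := by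
      rw [mul_one, one_div_mul_eq_div, div_le_iff₀ hc0]
      rw [div_le_iff₀ hε] at hcosh₁
      linarith
    linarith
  · intro w
    have hcw := Real.cosh_pos (w 0 - x₀)
    rcases le_or_gt |w 0 - x₀| R₁ with hw | hw
    · have : 0 ≤ 1 / Real.cosh R₁ * Real.cosh (w 0 - x₀) := by positivity
      linarith [hlow t₀ w le_rfl (by linarith) hw]
    · have h4 : Real.cosh R₁ ≤ Real.cosh (w 0 - x₀) := Real.cosh_le_cosh.2 (by
        rw [abs_of_pos hR₁0]; exact hw.le)
      have : 1 ≤ 1 / Real.cosh R₁ * Real.cosh (w 0 - x₀) := by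
        rw [one_div_mul_eq_div, le_div_iff₀ hc0]; linarith
      linarith [(hT.mem_Icc t₀ w ht₀).1]
  · intro t w h1 h2 h3
    have hcw := Real.cosh_pos (w 0 - x₀)
    have hT0 := (hT.mem_Icc t w (ht₀.trans h1.le)).1
    have he : 1 ≤ Real.exp (C * (t - t₀)) :=
      Real.one_le_exp (mul_nonneg (by linarith) (by linarith))
    have hpos : 0 ≤ 1 / Real.cosh R₁ * Real.cosh (w 0 - x₀) * Real.exp (C * (t - t₀)) := by
      positivity
    have hst : σ * (t - t₀) ≤ 1 - ε / 2 - η / 2 := by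
      rw [← hστ]; exact mul_le_mul_of_nonneg_left (by linarith) hσ0.le
    have hw : |w 0 - x₀| ≤ R₁ := by
      by_contra! hw
      have h4 : Real.cosh R₁ ≤ Real.cosh (w 0 - x₀) := Real.cosh_le_cosh.2 (by
        rw [abs_of_pos hR₁0]; exact hw.le)
      have h5 : 1 ≤ 1 / Real.cosh R₁ * Real.cosh (w 0 - x₀) := by
        rw [one_div_mul_eq_div, le_div_iff₀ hc0]; linarith
      have h6 : 1 ≤ 1 / Real.cosh R₁ * Real.cosh (w 0 - x₀) * Real.exp (C * (t - t₀)) :=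
        one_le_mul_of_one_le_of_one_le h5 he
      linarith
    have hl := hlow t w h1.le h2 hw
    exact ⟨by linarith, mul_le_mul_of_nonneg_left (hfκ _ ⟨by linarith, by linarith⟩) hM.le⟩

/-- Exponential upper bound for solutions with data vanishing for `|x| ≥ L`. -/
theorem IsCylSol.le_exp (hT : IsCylSol m h M u f T0 T) (hh : 0 < h) (hM : 0 < M) {K : NNReal}
    (hf : LipschitzOnWith K f (Icc 0 1)) (hf0 : f 0 = 0) {C L : ℝ}
    (hC : ∀ z, 1 + |u z 0| + M * K ≤ C) (hL : ∀ z, L ≤ |z 0| → T0 z = 0)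
    {t : ℝ} (ht : 0 ≤ t) (z : Fin (m + 1) → ℝ) : T t z ≤ Real.exp (L + C * t - |z 0|) := by
  obtain ⟨σ, hσ, hσz⟩ : ∃ σ : ℝ, |σ| = 1 ∧ |z 0| = σ * z 0 := by
    rcases le_total 0 (z 0) with h | h
    · exact ⟨1, by simp, by rw [abs_of_nonneg h, one_mul]⟩
    · exact ⟨-1, by simp, by rw [abs_of_nonpos h, neg_one_mul]⟩
  have hσ2 : σ * σ = 1 := by rw [← abs_mul_abs_self, hσ, one_mul]
  have hMK : 0 ≤ M * (K : ℝ) := mul_nonneg hM.le K.2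
  have hC0 : 0 ≤ C := by linarith [hC 0, abs_nonneg (u 0 0)]
  have key : ∀ δ, 0 < δ → T t z ≤
      Real.exp (C * t) * (Real.exp (L - σ * z 0) + δ * Real.exp (σ * z 0)) := by
    intro δ hδ
    refine hT.le_supersolution hh hM hf hf0 (t₁ := t) (R := |L| + |Real.log δ|)
      (φ := fun t z => Real.exp (C * t) * (Real.exp (L - σ * z 0) + δ * Real.exp (σ * z 0)))
      ?_ ?_ ?_ ?_ ?_ t z ht le_rfl
    · fun_prop
    · intro t z _ j
      simp
    · intro s w hs _ hlt
      have h1 := (hT.mem_Icc s w hs).2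
      have he : 1 ≤ Real.exp (C * s) := Real.one_le_exp (mul_nonneg hC0 hs)
      have hp1 := Real.exp_pos (L - σ * w 0)
      have hp2 : 0 < δ * Real.exp (σ * w 0) := mul_pos hδ (Real.exp_pos _)
      have h2 : Real.exp (L - σ * w 0) + δ * Real.exp (σ * w 0) ≤ 1 := by nlinarith
      have h3 : L - σ * w 0 ≤ 0 := by
        rw [← Real.exp_le_one_iff]; linarith
      have h4 : Real.log δ + σ * w 0 ≤ 0 := by
        rw [← Real.exp_le_one_iff, Real.exp_add, Real.exp_log hδ]; linarith
      have h5 : |w 0| = |σ * w 0| := by rw [abs_mul, hσ, one_mul]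
      rw [h5, abs_le]
      constructor <;> linarith [neg_abs_le L, neg_abs_le (Real.log δ), abs_nonneg L,
        abs_nonneg (Real.log δ)]
    · intro w
      rw [hT.init]
      simp only [mul_zero, Real.exp_zero, one_mul]
      have hp2 : 0 < δ * Real.exp (σ * w 0) := mul_pos hδ (Real.exp_pos _)
      rcases le_or_gt L |w 0| with h1 | h1
      · rw [hL w h1]; positivity
      · have h2 : 1 ≤ Real.exp (L - σ * w 0) := by
          apply Real.one_le_exp
          have : σ * w 0 ≤ |w 0| := by
            calc σ * w 0 ≤ |σ * w 0| := le_abs_self _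
              _ = |w 0| := by rw [abs_mul, hσ, one_mul]
          linarith
        have := (hT.mem_Icc 0 w le_rfl).2
        rw [hT.init] at this
        linarith
    · intro s w hs _ _
      set E := Real.exp (C * s) with hE
      have hE0 : 0 < E := Real.exp_pos _
      refine ⟨E * C * (Real.exp (L - σ * w 0) + δ * Real.exp (σ * w 0)), ?_, ?_, ?_⟩
      · have : HasDerivAt (fun s => Real.exp (C * s)) (E * C) s := by
          simpa using ((hasDerivAt_id s).const_mul C).exp
        exact this.mul_const _
      · have : ContDiff ℝ 2 fun w : Fin (m + 1) → ℝ =>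
            E * (Real.exp (L - σ * w 0) + δ * Real.exp (σ * w 0)) := by fun_prop
        exact this.contDiffAt
      · have e1 (r : ℝ) : HasDerivAt (fun r => Real.exp (L - σ * r))
            (Real.exp (L - σ * r) * (-σ)) r := by
          simpa using (((hasDerivAt_id r).const_mul σ).const_sub L).exp
        have e2 (r : ℝ) : HasDerivAt (fun r => Real.exp (σ * r)) (Real.exp (σ * r) * σ) r := by
          simpa using ((hasDerivAt_id r).const_mul σ).exp
        have d1 (r : ℝ) : HasDerivAt (fun r => E * (Real.exp (L - σ * r) + δ * Real.exp (σ * r)))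
            (E * (Real.exp (L - σ * r) * (-σ) + δ * (Real.exp (σ * r) * σ))) r :=
          ((e1 r).add ((e2 r).const_mul δ)).const_mul E
        have d2 (r : ℝ) : HasDerivAt
            (fun r => E * (Real.exp (L - σ * r) * (-σ) + δ * (Real.exp (σ * r) * σ)))
            (E * (Real.exp (L - σ * r) * (-σ) * (-σ) + δ * (Real.exp (σ * r) * σ * σ))) r :=
          (((e1 r).mul_const _).add (((e2 r).mul_const _).const_mul δ)).const_mul E
        obtain ⟨g1, g2⟩ := drift_lap_comp_eval d1 d2 (u w) w
        rw [g1, g2]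
        set a := Real.exp (L - σ * w 0)
        set b := δ * Real.exp (σ * w 0) with hb
        have ha0 : 0 < a := Real.exp_pos _
        have hb0 : 0 < b := mul_pos hδ (Real.exp_pos _)
        have r1 : E * (a * (-σ) * (-σ) + δ * (Real.exp (σ * w 0) * σ * σ)) = E * (a + b) := by
          rw [hb]; linear_combination (E * a + E * δ * Real.exp (σ * w 0)) * hσ2
        have r2 : u w 0 * (E * (a * (-σ) + δ * (Real.exp (σ * w 0) * σ)))
            = E * (u w 0 * σ * (b - a)) := by rw [hb]; ring
        rw [r1, r2]
        have hu : |u w 0 * σ| = |u w 0| := by rw [abs_mul, hσ, mul_one]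
        have h1 := abs_le.1 hu.le
        have h2 : -(|u w 0| * (a + b)) ≤ u w 0 * σ * (b - a) := by nlinarith [h1.1, h1.2]
        have h3 : (1 + |u w 0| + M * K) * (a + b) ≤ C * (a + b) :=
          mul_le_mul_of_nonneg_right (hC w) (by positivity)
        have h4 : 0 ≤ E * (C * (a + b) + u w 0 * σ * (b - a) - (a + b) - M * K * (a + b)) :=
          mul_nonneg hE0.le (by linarith)
        linarith
  have hlim : Tendsto (fun δ : ℝ =>
      Real.exp (C * t) * (Real.exp (L - σ * z 0) + δ * Real.exp (σ * z 0))) (𝓝[>] 0)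
      (𝓝 (Real.exp (L + C * t - |z 0|))) := by
    have hcont : Continuous fun δ : ℝ =>
      Real.exp (C * t) * (Real.exp (L - σ * z 0) + δ * Real.exp (σ * z 0)) := by fun_prop
    have := hcont.tendsto 0
    rw [zero_mul, add_zero, ← Real.exp_add] at this
    rw [show L + C * t - |z 0| = C * t + (L - σ * z 0) by rw [hσz]; ring]
    exact this.mono_left nhdsWithin_le_nhds
  exact ge_of_tendsto hlim (eventually_nhdsWithin_of_forall key)

end Spreading

lemma hasDerivAt_max_zero_cube (x : ℝ) :
    HasDerivAt (fun x : ℝ => max 0 x ^ 3) (3 * max 0 x ^ 2) x := by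
  rcases lt_trichotomy x 0 with h | rfl | h
  · rw [max_eq_left h.le]
    refine ((hasDerivAt_const x (0:ℝ)).congr_of_eventuallyEq ?_).congr_deriv (by simp)
    filter_upwards [Iio_mem_nhds h] with y hy
    simp [max_eq_left (mem_Iio.1 hy).le]
  · rw [hasDerivAt_iff_isLittleO]
    simp only [max_self, sub_zero, ne_eq, OfNat.ofNat_ne_zero, not_false_eq_true, zero_pow,
      mul_zero, smul_zero]
    refine Asymptotics.IsBigO.trans_isLittleO (g := fun x : ℝ => x ^ 3) ?_ ?_
    · refine Asymptotics.isBigO_of_le _ fun y => ?_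
      rw [norm_pow, norm_pow]
      gcongr
      rw [Real.norm_eq_abs, Real.norm_eq_abs, abs_of_nonneg (le_max_left _ _)]
      exact max_le (abs_nonneg _) (le_abs_self _)
    · simpa using Asymptotics.isLittleO_pow_pow (𝕜 := ℝ) (m := 1) (n := 3) (by norm_num)
  · rw [max_eq_right h.le]
    refine (by simpa using hasDerivAt_pow 3 x : HasDerivAt (fun x : ℝ => x ^ 3)
      (3 * x ^ 2) x).congr_of_eventuallyEq ?_
    filter_upwards [Ioi_mem_nhds h] with y hy
    simp [max_eq_right (mem_Ioi.1 hy).le]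

lemma hasDerivAt_max_zero_sq (x : ℝ) :
    HasDerivAt (fun x : ℝ => max 0 x ^ 2) (2 * max 0 x) x := by
  rcases lt_trichotomy x 0 with h | rfl | h
  · rw [max_eq_left h.le]
    refine ((hasDerivAt_const x (0:ℝ)).congr_of_eventuallyEq ?_).congr_deriv (by simp)
    filter_upwards [Iio_mem_nhds h] with y hy
    simp [max_eq_left (mem_Iio.1 hy).le]
  · rw [hasDerivAt_iff_isLittleO]
    simp only [max_self, sub_zero, ne_eq, OfNat.ofNat_ne_zero, not_false_eq_true, zero_pow,
      mul_zero, smul_zero]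
    refine Asymptotics.IsBigO.trans_isLittleO (g := fun x : ℝ => x ^ 2) ?_ ?_
    · refine Asymptotics.isBigO_of_le _ fun y => ?_
      rw [norm_pow, norm_pow]
      gcongr
      rw [Real.norm_eq_abs, Real.norm_eq_abs, abs_of_nonneg (le_max_left _ _)]
      exact max_le (abs_nonneg _) (le_abs_self _)
    · simpa using Asymptotics.isLittleO_pow_pow (𝕜 := ℝ) (m := 1) (n := 2) (by norm_num)
  · rw [max_eq_right h.le]
    refine (by simpa using hasDerivAt_pow 2 x : HasDerivAt (fun x : ℝ => x ^ 2)
      (2 * x) x).congr_of_eventuallyEq ?_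
    filter_upwards [Ioi_mem_nhds h] with y hy
    simp [max_eq_right (mem_Ioi.1 hy).le]

/-- A nondecreasing `C²` profile, affine for `w ≤ 1`, equal to `3/8` for `w ≥ 3`. -/
def profile (w : ℝ) : ℝ :=
  (w - 1 / 2 - (max 0 (w - 1) ^ 3 - 2 * max 0 (w - 2) ^ 3 + max 0 (w - 3) ^ 3) / 6) / 4

/-- The derivative of `profile`. -/
def profile' (w : ℝ) : ℝ :=
  (1 - (max 0 (w - 1) ^ 2 - 2 * max 0 (w - 2) ^ 2 + max 0 (w - 3) ^ 2) / 2) / 4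

/-- The second derivative of `profile`. -/
def profile'' (w : ℝ) : ℝ :=
  -(max 0 (w - 1) - 2 * max 0 (w - 2) + max 0 (w - 3)) / 4

lemma hasDerivAt_profile (w : ℝ) : HasDerivAt profile (profile' w) w := by
  have h (a : ℝ) : HasDerivAt (fun w => max 0 (w - a) ^ 3) (3 * max 0 (w - a) ^ 2) w :=
    HasDerivAt.comp_sub_const w a (hasDerivAt_max_zero_cube (w - a))
  have := ((((hasDerivAt_id w).sub_const (1 / 2)).sub
    ((((h 1).sub ((h 2).const_mul 2)).add (h 3)).div_const 6)).div_const 4)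
  refine this.congr_deriv ?_
  rw [profile']; ring

lemma hasDerivAt_profile' (w : ℝ) : HasDerivAt profile' (profile'' w) w := by
  have h (a : ℝ) : HasDerivAt (fun w => max 0 (w - a) ^ 2) (2 * max 0 (w - a)) w :=
    HasDerivAt.comp_sub_const w a (hasDerivAt_max_zero_sq (w - a))
  have := (((((h 1).sub ((h 2).const_mul 2)).add (h 3)).div_const 2).const_sub 1).div_const 4
  refine this.congr_deriv ?_
  rw [profile'']; ring

lemma contDiff_profile : ContDiff ℝ 2 profile := by
  have h1 : deriv profile = profile' := funext fun w => (hasDerivAt_profile w).deriv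
  have h2 : deriv profile' = profile'' := funext fun w => (hasDerivAt_profile' w).deriv
  rw [show (2 : WithTop ℕ∞) = 1 + 1 by norm_num, contDiff_succ_iff_deriv, h1,
    show (1 : WithTop ℕ∞) = 0 + 1 by norm_num, contDiff_succ_iff_deriv, h2, contDiff_zero]
  refine ⟨fun w => (hasDerivAt_profile w).differentiableAt, by simp,
    fun w => (hasDerivAt_profile' w).differentiableAt, by simp, ?_⟩
  unfold profile''
  fun_prop

lemma profile_of_le_one {w : ℝ} (hw : w ≤ 1) : profile w = (w - 1 / 2) / 4 := by
  rw [profile, max_eq_left (by linarith), max_eq_left (by linarith), max_eq_left (by linarith)]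
  ring

lemma profile_of_three_le {w : ℝ} (hw : 3 ≤ w) : profile w = 3 / 8 := by
  rw [profile, max_eq_right (by linarith), max_eq_right (by linarith), max_eq_right (by linarith)]
  ring

lemma profile'_nonneg (w : ℝ) : 0 ≤ profile' w := by
  rw [profile']
  rcases le_total w 1 with h1 | h1
  · rw [max_eq_left (by linarith), max_eq_left (by linarith), max_eq_left (by linarith)]
    norm_num
  rcases le_total w 2 with h2 | h2
  · rw [max_eq_right (by linarith), max_eq_left (by linarith), max_eq_left (by linarith)]
    nlinarith
  rcases le_total w 3 with h3 | h3
  · rw [max_eq_right (by linarith), max_eq_right (by linarith), max_eq_left (by linarith)]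
    nlinarith [sq_nonneg (w - 3)]
  · rw [max_eq_right (by linarith), max_eq_right (by linarith), max_eq_right (by linarith)]
    nlinarith

lemma monotone_profile : Monotone profile :=
  monotone_of_deriv_nonneg (fun w => (hasDerivAt_profile w).differentiableAt) fun w => by
    rw [(hasDerivAt_profile w).deriv]; exact profile'_nonneg w

lemma profile_le (w : ℝ) : profile w ≤ 3 / 8 := by
  rw [← profile_of_three_le (le_max_right w 3)]
  exact monotone_profile (le_max_left _ _)

lemma profile''_of_le_one {w : ℝ} (hw : w ≤ 1) : profile'' w = 0 := by
  rw [profile'', max_eq_left (by linarith), max_eq_left (by linarith), max_eq_left (by linarith)]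
  ring

lemma profile''_of_three_le {w : ℝ} (hw : 3 ≤ w) : profile'' w = 0 := by
  rw [profile'', max_eq_right (by linarith), max_eq_right (by linarith),
    max_eq_right (by linarith)]
  ring

lemma neg_profile''_le (w : ℝ) : -profile'' w ≤ 1 / 4 := by
  rw [profile'']
  rcases le_total w 2 with h | h
  · have := max_le (a := 0) (b := w - 1) (c := 1) (by norm_num) (by linarith)
    rw [max_eq_left (show w - 2 ≤ 0 by linarith), max_eq_left (show w - 3 ≤ 0 by linarith)]
    linarith
  · have := max_le (a := 0) (b := w - 3) (c := w - 2) (by linarith) (by linarith)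
    rw [max_eq_right (show 0 ≤ w - 1 by linarith), max_eq_right (show 0 ≤ w - 2 by linarith)]
    linarith

section Travelling

variable {m : ℕ} {h M : ℝ} {u : (Fin (m + 1) → ℝ) → Fin (m + 1) → ℝ} {f : ℝ → ℝ}

/-- The profile of an exponential travelling subsolution is a subsolution where it is positive. -/
lemma profile_exp_subsolution (hM : 0 < M) (hf0 : ∀ s ∈ Ico (0:ℝ) 1, 0 ≤ f s) {κ : ℝ}
    (hκ : ∀ s ∈ Icc (1 / 8 : ℝ) (3 / 8), κ ≤ f s) {Q : (Fin (m + 1) → ℝ) → ℝ}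
    (hQ : ContDiff ℝ 2 Q) {c A t₀ : ℝ} {z : Fin (m + 1) → ℝ}
    (hQ1 : c ≤ lap Q z + ∑ i, pd i Q z ^ 2 - ∑ i, u z i * pd i Q z)
    (hQ2 : 9 / 4 * ∑ i, pd i Q z ^ 2 ≤ M * κ) (t : ℝ)
    (hpos : 0 < profile (Real.exp (Q z + (c * (t - t₀) + A)))) :
    ∃ a, HasDerivAt (fun s => profile (Real.exp (Q z + (c * (s - t₀) + A)))) a t ∧
      ContDiffAt ℝ 2 (fun w => profile (Real.exp (Q w + (c * (t - t₀) + A)))) z ∧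
      a + ∑ i, u z i * pd i (fun w => profile (Real.exp (Q w + (c * (t - t₀) + A)))) z ≤
        lap (fun w => profile (Real.exp (Q w + (c * (t - t₀) + A)))) z +
          M * f (profile (Real.exp (Q z + (c * (t - t₀) + A)))) := by
  set b := c * (t - t₀) + A with hb
  set W := Real.exp (Q z + b) with hW
  have hW0 : 0 < W := Real.exp_pos _
  have d0 (s : ℝ) : HasDerivAt (fun s => Real.exp (s + b)) (Real.exp (s + b)) s := by
    simpa using ((hasDerivAt_id s).add_const b).exp
  have d1 (s : ℝ) : HasDerivAt (fun s => profile (Real.exp (s + b)))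
      (profile' (Real.exp (s + b)) * Real.exp (s + b)) s :=
    (hasDerivAt_profile _).comp s (d0 s)
  have d2 (s : ℝ) : HasDerivAt (fun s => profile' (Real.exp (s + b)) * Real.exp (s + b))
      (profile'' (Real.exp (s + b)) * Real.exp (s + b) * Real.exp (s + b) +
        profile' (Real.exp (s + b)) * Real.exp (s + b)) s :=
    ((hasDerivAt_profile' _).comp s (d0 s)).mul (d0 s)
  refine ⟨profile' W * (W * c), ?_, ?_, ?_⟩
  · have : HasDerivAt (fun s => Real.exp (Q z + (c * (s - t₀) + A))) (W * c) t := by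
      simpa using (((((hasDerivAt_id t).sub_const t₀).const_mul c).add_const A).const_add (Q z)).exp
    exact (hasDerivAt_profile _).comp t this
  · exact (contDiff_profile.comp (Real.contDiff_exp.comp (hQ.add contDiff_const))).contDiffAt
  · rw [lap_comp d1 d2 hQ]
    simp_rw [fun i => pd_comp i (d1 (Q z)) (hQ.differentiable (by simp) z)]
    rw [← hW]
    have e : ∑ i, u z i * (profile' W * W * pd i Q z) =
        profile' W * W * ∑ i, u z i * pd i Q z := by
      rw [Finset.mul_sum]; exact Finset.sum_congr rfl fun i _ => by ring
    rw [e]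
    set S := ∑ i, pd i Q z ^ 2
    have hS : 0 ≤ S := Finset.sum_nonneg fun i _ => sq_nonneg _
    have hg' : 0 ≤ profile' W * W := mul_nonneg (profile'_nonneg W) hW0.le
    have h1 := mul_le_mul_of_nonneg_left hQ1 hg'
    have hle := profile_le W
    have hMf : 0 ≤ M * f (profile W) := mul_nonneg hM.le (hf0 _ ⟨hpos.le, by linarith⟩)
    have h2 : -profile'' W * W * W * S ≤ M * f (profile W) := by
      rcases le_or_gt W 1 with hw | hw
      · simpa [profile''_of_le_one hw] using hMf
      rcases le_or_gt 3 W with hw3 | hw3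
      · simpa [profile''_of_three_le hw3] using hMf
      · have h3 : (1:ℝ) / 8 ≤ profile W := by
          calc (1:ℝ) / 8 = profile 1 := by rw [profile_of_le_one le_rfl]; norm_num
            _ ≤ _ := monotone_profile hw.le
        have h4 := mul_le_mul_of_nonneg_left (hκ _ ⟨h3, hle⟩) hM.le
        have h5 : -profile'' W * W * W ≤ 1 / 4 * 3 * 3 := by
          have h6 : W * W ≤ 9 := by nlinarith
          have h7 := mul_le_mul_of_nonneg_right (neg_profile''_le W) (mul_pos hW0 hW0).le
          linarith
        have h8 := mul_le_mul_of_nonneg_right h5 hS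
        linarith
    nlinarith

/-- Two travelling exponential subsolutions, one for each direction, force a solution that is
large on a long interval to spread linearly in both directions. -/
theorem exists_linear_spreading (hh : 0 < h) (hM : 0 < M) {K : NNReal}
    (hf : LipschitzOnWith K f (Icc 0 1)) (hf0 : ∀ s ∈ Ico (0:ℝ) 1, 0 ≤ f s) {κ : ℝ}
    (hκ : ∀ s ∈ Icc (1 / 8 : ℝ) (3 / 8), κ ≤ f s) {Q₁ Q₂ : (Fin (m + 1) → ℝ) → ℝ}
    (hQ₁ : ContDiff ℝ 2 Q₁) (hQ₂ : ContDiff ℝ 2 Q₂)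
    (hp₁ : ∀ z, ∀ j : Fin m, Q₁ (z + Pi.single j.succ h) = Q₁ z)
    (hp₂ : ∀ z, ∀ j : Fin m, Q₂ (z + Pi.single j.succ h) = Q₂ z) {c μ B : ℝ} (hc : 0 < c)
    (hμ : 0 < μ) (hB : 0 ≤ B)
    (hb₁ : ∀ z, |Q₁ z + μ * z 0| ≤ B) (hb₂ : ∀ z, |Q₂ z - μ * z 0| ≤ B)
    (hi₁ : ∀ z, c ≤ lap Q₁ z + ∑ i, pd i Q₁ z ^ 2 - ∑ i, u z i * pd i Q₁ z)
    (hi₂ : ∀ z, c ≤ lap Q₂ z + ∑ i, pd i Q₂ z ^ 2 - ∑ i, u z i * pd i Q₂ z)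
    (hs₁ : ∀ z, 9 / 4 * ∑ i, pd i Q₁ z ^ 2 ≤ M * κ)
    (hs₂ : ∀ z, 9 / 4 * ∑ i, pd i Q₂ z ^ 2 ≤ M * κ) :
    ∃ L : ℝ, 0 < L ∧ ∀ T0 T, IsCylSol m h M u f T0 T → ∀ t₀ : ℝ, 0 ≤ t₀ →
      (∀ z, |z 0| ≤ L → 1 / 2 ≤ T t₀ z) →
      ∀ t z, t₀ ≤ t → |z 0| ≤ c / μ * (t - t₀) → 3 / 8 ≤ T t z := by
  set A := μ + B + 2 with hA
  refine ⟨(A + B + 1) / μ, by positivity, fun T0 T hT t₀ ht₀ hinit t z ht hz => ?_⟩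
  have hexp2 : (3:ℝ) ≤ Real.exp 2 := by linarith [Real.add_one_le_exp (2:ℝ)]
  have hexp1 : Real.exp (-1) ≤ 1 / 2 := by
    rw [Real.exp_neg, one_div]
    exact inv_anti₀ two_pos (by linarith [Real.add_one_le_exp (1:ℝ)])
  have hflat {x : ℝ} (hx : 2 ≤ x) : profile (Real.exp x) = 3 / 8 :=
    profile_of_three_le (hexp2.trans (Real.exp_le_exp.2 hx))
  have hlow {x : ℝ} (hx : x ≤ -1) : profile (Real.exp x) ≤ 0 := by
    have h1 : Real.exp x ≤ 1 / 2 := (Real.exp_le_exp.2 hx).trans hexp1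
    rw [profile_of_le_one (by linarith)]
    linarith
  set g₁ : ℝ → (Fin (m + 1) → ℝ) → ℝ :=
    fun s w => profile (Real.exp (Q₁ w + (c * (s - t₀) + A))) with hg₁
  set g₂ : ℝ → (Fin (m + 1) → ℝ) → ℝ :=
    fun s w => profile (Real.exp (Q₂ w + (c * (s - t₀) + A))) with hg₂
  have hflat₁ : ∀ s w, t₀ ≤ s → w 0 ≤ 1 → g₁ s w = 3 / 8 := by
    intro s w hs hw
    refine hflat ?_
    have h1 := (abs_le.1 (hb₁ w)).1
    have h2 := mul_nonneg hc.le (sub_nonneg.2 hs)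
    nlinarith
  have hflat₂ : ∀ s w, t₀ ≤ s → -1 ≤ w 0 → g₂ s w = 3 / 8 := by
    intro s w hs hw
    refine hflat ?_
    have h1 := (abs_le.1 (hb₂ w)).1
    have h2 := mul_nonneg hc.le (sub_nonneg.2 hs)
    nlinarith
  have hv₁ : ∀ s w, t₀ ≤ s → -1 ≤ w 0 → g₁ s w + g₂ s w - 3 / 8 = g₁ s w := by
    intro s w hs hw
    rw [hflat₂ s w hs hw]; ring
  have hv₂ : ∀ s w, t₀ ≤ s → w 0 ≤ 1 → g₁ s w + g₂ s w - 3 / 8 = g₂ s w := by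
    intro s w hs hw
    rw [hflat₁ s w hs hw]; ring
  have hc₁ : Continuous fun p : ℝ × (Fin (m + 1) → ℝ) => g₁ p.1 p.2 := by
    have := hQ₁.continuous
    exact contDiff_profile.continuous.comp (by fun_prop)
  have hc₂ : Continuous fun p : ℝ × (Fin (m + 1) → ℝ) => g₂ p.1 p.2 := by
    have := hQ₂.continuous
    exact contDiff_profile.continuous.comp (by fun_prop)
  have hbd : ∀ s w, t₀ ≤ s → 0 < g₁ s w + g₂ s w - 3 / 8 →
      μ * |w 0| ≤ A + B + 1 + c * (s - t₀) := by
    intro s w hs hpos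
    rcases le_total 0 (w 0) with hw | hw
    · rw [hv₁ s w hs (by linarith)] at hpos
      have h1 : -1 < Q₁ w + (c * (s - t₀) + A) := by
        by_contra! hle
        exact absurd (hlow hle) (not_le.2 hpos)
      have h2 := (abs_le.1 (hb₁ w)).2
      rw [abs_of_nonneg hw]
      linarith
    · rw [hv₂ s w hs (by linarith)] at hpos
      have h1 : -1 < Q₂ w + (c * (s - t₀) + A) := by
        by_contra! hle
        exact absurd (hlow hle) (not_le.2 hpos)
      have h2 := (abs_le.1 (hb₂ w)).2
      rw [abs_of_nonpos hw]
      linarith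
  have hle38 : ∀ s w, g₁ s w + g₂ s w - 3 / 8 ≤ 3 / 8 := fun s w => by
    linarith [profile_le (Real.exp (Q₁ w + (c * (s - t₀) + A))),
      profile_le (Real.exp (Q₂ w + (c * (s - t₀) + A)))]
  have hcomp := hT.subsolution_le hh hM hf (t₁ := t) (R := (A + B + 1 + c * (t - t₀)) / μ) ht₀
    (φ := fun s w => g₁ s w + g₂ s w - 3 / 8)
    ((hc₁.add hc₂).sub continuous_const).continuousOn ?_ ?_ ?_ ?_ t z ht le_rfl
  · refine le_trans (le_of_eq ?_) hcomp
    have hct : μ * |z 0| ≤ c * (t - t₀) := by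
      rw [div_mul_eq_mul_div, le_div_iff₀ hμ] at hz
      linarith
    have h3 : (3:ℝ) / 8 = 3 / 8 + 3 / 8 - 3 / 8 := by norm_num
    rcases le_total 0 (z 0) with hw | hw
    · rw [hv₁ t z ht (by linarith)]
      refine (hflat ?_).symm
      rw [abs_of_nonneg hw] at hct
      linarith [(abs_le.1 (hb₁ z)).1]
    · rw [hv₂ t z ht (by linarith)]
      refine (hflat ?_).symm
      rw [abs_of_nonpos hw] at hct
      linarith [(abs_le.1 (hb₂ z)).1]
  · intro s w _ j
    simp only [hg₁, hg₂, hp₁, hp₂]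
  · intro s w hs hst hlt
    have h1 := hbd s w hs ((hT.mem_Icc s w (ht₀.trans hs)).1.trans_lt hlt)
    rw [le_div_iff₀ hμ]
    have := mul_le_mul_of_nonneg_left hst hc.le
    linarith
  · intro w
    rcases le_or_gt |w 0| ((A + B + 1) / μ) with hw | hw
    · linarith [hinit w hw, hle38 t₀ w]
    · refine le_trans ?_ (hT.mem_Icc t₀ w ht₀).1
      by_contra! hpos
      have := hbd t₀ w le_rfl hpos
      rw [div_lt_iff₀ hμ] at hw
      linarith
  · intro s w hs _ hlt
    have hpos := (hT.mem_Icc s w (ht₀.trans hs.le)).1.trans_lt hlt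
    refine ⟨(hle38 s w).trans (by norm_num), ?_⟩
    rcases le_total 0 (w 0) with hw | hw
    · have hS : (fun w => g₁ s w + g₂ s w - 3 / 8) =ᶠ[𝓝 w] g₁ s := by
        filter_upwards [(continuous_apply (0 : Fin (m + 1))).tendsto w (Ioi_mem_nhds
          (show (-1:ℝ) < w 0 by linarith))] with w' hw'
        exact hv₁ s w' hs.le (le_of_lt hw')
      have hE : (fun r => g₁ r w + g₂ r w - 3 / 8) =ᶠ[𝓝 s] fun r => g₁ r w := by
        filter_upwards [Ioi_mem_nhds hs] with r hr
        exact hv₁ r w (le_of_lt hr) (by linarith)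
      rw [hv₁ s w hs.le (by linarith)] at hpos ⊢
      obtain ⟨a, h1, h2, h3⟩ := profile_exp_subsolution (u := u) hM hf0 hκ hQ₁ (hi₁ w) (hs₁ w) s hpos
      refine ⟨a, h1.congr_of_eventuallyEq hE, h2.congr_of_eventuallyEq hS, ?_⟩
      rw [lap_congr hS]
      simp_rw [fun i => pd_congr i hS]
      exact h3
    · have hS : (fun w => g₁ s w + g₂ s w - 3 / 8) =ᶠ[𝓝 w] g₂ s := by
        filter_upwards [(continuous_apply (0 : Fin (m + 1))).tendsto w (Iio_mem_nhds
          (show w 0 < (1:ℝ) by linarith))] with w' hw'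
        exact hv₂ s w' hs.le (le_of_lt hw')
      have hE : (fun r => g₁ r w + g₂ r w - 3 / 8) =ᶠ[𝓝 s] fun r => g₂ r w := by
        filter_upwards [Ioi_mem_nhds hs] with r hr
        exact hv₂ r w (le_of_lt hr) (by linarith)
      rw [hv₂ s w hs.le (by linarith)] at hpos ⊢
      obtain ⟨a, h1, h2, h3⟩ := profile_exp_subsolution (u := u) hM hf0 hκ hQ₂ (hi₂ w) (hs₂ w) s hpos
      refine ⟨a, h1.congr_of_eventuallyEq hE, h2.congr_of_eventuallyEq hS, ?_⟩
      rw [lap_congr hS]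
      simp_rw [fun i => pd_congr i hS]
      exact h3

end Travelling

lemma summable_int_one_add_norm_sq_inv : Summable fun n : ℤ => ((1 + ‖n‖) ^ 2)⁻¹ := by
  refine Summable.of_nonneg_of_le (fun n => by positivity) (fun n => ?_)
    ((Real.summable_one_div_int_add_rpow (1 / 2) 2).2 (by norm_num))
  have h2 : (n : ℝ) + 1 / 2 ≠ 0 := by
    intro h
    have : (2 * n + 1 : ℤ) = 0 := by
      have : (2 * n + 1 : ℝ) = 0 := by linarith
      exact_mod_cast this
    omega
  have h3 : |(n : ℝ) + 1 / 2| ≤ 1 + ‖n‖ := by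
    rw [Int.norm_eq_abs]
    refine (abs_add_le _ _).trans ?_
    norm_num
    linarith
  rw [one_div, Real.rpow_two]
  have := abs_pos.2 h2
  gcongr

lemma summable_one_add_norm_pow_inv (N : ℕ) :
    Summable fun k : Fin N → ℤ => ((1 + ‖k‖) ^ (2 * N))⁻¹ := by
  refine summable_of_sum_le (c := (∑' n : ℤ, ((1 + ‖n‖) ^ 2)⁻¹) ^ N)
    (fun k => by positivity) fun s => ?_
  calc ∑ k ∈ s, ((1 + ‖k‖) ^ (2 * N))⁻¹
      ≤ ∑ k ∈ s, ∏ i, ((1 + ‖k i‖) ^ 2)⁻¹ := by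
        gcongr with k
        rw [Finset.prod_inv_distrib]
        refine inv_anti₀ (Finset.prod_pos fun i _ => by positivity) ?_
        rw [pow_mul]
        calc ∏ i, (1 + ‖k i‖) ^ 2 ≤ ∏ _i : Fin N, (1 + ‖k‖) ^ 2 := by
              refine Finset.prod_le_prod (fun i _ => by positivity) fun i _ => ?_
              have := norm_le_pi_norm k i
              gcongr
          _ = _ := by rw [Finset.prod_const, Finset.card_univ, Fintype.card_fin]
    _ ≤ ∑ k ∈ Fintype.piFinset fun i => s.image fun k => k i, ∏ i, ((1 + ‖k i‖) ^ 2)⁻¹ := by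
        refine Finset.sum_le_sum_of_subset_of_nonneg (fun k hk => ?_)
          fun k _ _ => Finset.prod_nonneg fun i _ => by positivity
        exact Fintype.mem_piFinset.2 fun i => Finset.mem_image_of_mem _ hk
    _ = ∏ i : Fin N, ∑ n ∈ s.image fun k => k i, ((1 + ‖n‖) ^ 2)⁻¹ :=
        (Finset.prod_univ_sum (fun i => s.image fun k => k i)
          fun (_ : Fin N) (n : ℤ) => ((1 + ‖n‖) ^ 2)⁻¹).symm
    _ ≤ ∏ _i : Fin N, ∑' n : ℤ, ((1 + ‖n‖) ^ 2)⁻¹ := by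
        refine Finset.prod_le_prod (fun i _ => Finset.sum_nonneg fun n _ => by positivity)
          fun i _ => ?_
        exact summable_int_one_add_norm_sq_inv.sum_le_tsum _ fun n _ => by positivity
    _ = _ := by rw [Finset.prod_const, Finset.card_univ, Fintype.card_fin]

/-- Decay of a multi-indexed sequence faster than every power of the index. -/
def RapidDecay {N : ℕ} (c : (Fin N → ℤ) → ℂ) : Prop :=
  ∀ n : ℕ, ∃ C, ∀ k, (1 + ‖k‖) ^ n * ‖c k‖ ≤ C

namespace RapidDecay

variable {N : ℕ} {c : (Fin N → ℤ) → ℂ}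

lemma summable_pow_mul_norm (hc : RapidDecay c) (n : ℕ) :
    Summable fun k => (1 + ‖k‖) ^ n * ‖c k‖ := by
  obtain ⟨C, hC⟩ := hc (n + 2 * N)
  refine Summable.of_nonneg_of_le (fun k => by positivity) (fun k => ?_)
    ((summable_one_add_norm_pow_inv N).mul_left C)
  rw [← div_eq_mul_inv, le_div_iff₀ (by positivity)]
  refine le_of_eq_of_le ?_ (hC k)
  ring

lemma summable_norm (hc : RapidDecay c) : Summable fun k => ‖c k‖ := by
  simpa using hc.summable_pow_mul_norm 0

lemma mul_coord (hc : RapidDecay c) (w : ℂ) (i : Fin N) :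
    RapidDecay fun k => w * k i * c k := by
  intro n
  obtain ⟨C, hC⟩ := hc (n + 1)
  refine ⟨‖w‖ * C, fun k => ?_⟩
  have h1 : ‖((k i : ℤ) : ℂ)‖ ≤ 1 + ‖k‖ := by
    rw [Complex.norm_intCast]
    have := norm_le_pi_norm k i
    rw [Int.norm_eq_abs] at this
    linarith
  calc (1 + ‖k‖) ^ n * ‖w * k i * c k‖ = ‖w‖ * ((1 + ‖k‖) ^ n * (‖((k i : ℤ) : ℂ)‖ * ‖c k‖)) := by
        rw [norm_mul, norm_mul]; ring
    _ ≤ ‖w‖ * ((1 + ‖k‖) ^ n * ((1 + ‖k‖) * ‖c k‖)) := by gcongr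
    _ = ‖w‖ * ((1 + ‖k‖) ^ (n + 1) * ‖c k‖) := by ring
    _ ≤ ‖w‖ * C := by gcongr; exact hC k

end RapidDecay

/-- Energy identity for an antihermitian matrix plus a real diagonal. -/
lemma sum_mul_norm_sq_eq {ι : Type*} [Fintype ι] {q : ι → ℝ} {a : ι → ι → ℂ}
    (ha : ∀ k l, (starRingEnd ℂ) (a k l) = -a l k) (c : ι → ℂ) :
    ∑ k, q k * ‖c k‖ ^ 2
      = (∑ k, (starRingEnd ℂ) (c k) * (q k * c k + ∑ l, a k l * c l)).re := by
  have h1 : (∑ k, (starRingEnd ℂ) (c k) * ∑ l, a k l * c l).re = 0 := by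
    set S := ∑ k, (starRingEnd ℂ) (c k) * ∑ l, a k l * c l with hS
    have : (starRingEnd ℂ) S = -S := by
      rw [hS, map_sum]
      simp only [Finset.mul_sum, map_mul, map_sum, RCLike.conj_conj, ha]
      rw [Finset.sum_comm, ← Finset.sum_neg_distrib]
      refine Finset.sum_congr rfl fun k _ => ?_
      rw [← Finset.sum_neg_distrib]
      exact Finset.sum_congr rfl fun l _ => by ring
    have := congrArg Complex.re this
    rw [Complex.conj_re, Complex.neg_re] at this
    linarith
  simp only [mul_add, Finset.sum_add_distrib, Complex.add_re, h1, add_zero]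
  rw [Complex.re_sum]
  refine Finset.sum_congr rfl fun k _ => ?_
  rw [mul_left_comm, Complex.conj_mul', ← Complex.ofReal_pow, ← Complex.ofReal_mul,
    Complex.ofReal_re]

lemma exists_finite_solution {ι : Type*} [Fintype ι] {q : ι → ℝ} (hq : ∀ k, 0 < q k)
    {a : ι → ι → ℂ} (ha : ∀ k l, (starRingEnd ℂ) (a k l) = -a l k) (b : ι → ℂ) :
    ∃ c : ι → ℂ, (∀ k, q k * c k + ∑ l, a k l * c l = b k) ∧
      ∑ k, q k * ‖c k‖ ^ 2 ≤ ∑ k, ‖b k‖ ^ 2 / q k := by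
  let A : (ι → ℂ) →ₗ[ℂ] (ι → ℂ) :=
    { toFun := fun c k => q k * c k + ∑ l, a k l * c l
      map_add' := fun c d => by
        ext k
        simp only [Pi.add_apply, mul_add, Finset.sum_add_distrib]
        ring
      map_smul' := fun w c => by
        ext k
        simp only [Pi.smul_apply, smul_eq_mul, RingHom.id_apply, mul_add, Finset.mul_sum]
        congr 1
        · ring
        · exact Finset.sum_congr rfl fun l _ => by ring }
  have hA (c : ι → ℂ) : ∑ k, q k * ‖c k‖ ^ 2 = (∑ k, (starRingEnd ℂ) (c k) * A c k).re :=
    sum_mul_norm_sq_eq ha c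
  have hinj : Function.Injective A := by
    rw [← LinearMap.ker_eq_bot, LinearMap.ker_eq_bot']
    intro c hc
    have h1 := hA c
    simp only [hc, Pi.zero_apply, mul_zero, Finset.sum_const_zero, Complex.zero_re] at h1
    rw [Finset.sum_eq_zero_iff_of_nonneg fun k _ => by have := hq k; positivity] at h1
    ext k
    have := h1 k (Finset.mem_univ k)
    simpa [(hq k).ne'] using this
  obtain ⟨c, hc⟩ := LinearMap.injective_iff_surjective.1 hinj b
  refine ⟨c, fun k => congrFun hc k, ?_⟩
  have h1 : ∑ k, q k * ‖c k‖ ^ 2 ≤ ∑ k, (q k * ‖c k‖ ^ 2 + ‖b k‖ ^ 2 / q k) / 2 := by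
    rw [hA c, hc, Complex.re_sum]
    refine Finset.sum_le_sum fun k _ => ((Complex.re_le_norm _).trans ?_)
    rw [norm_mul, RCLike.norm_conj]
    have h2 : q k * ‖c k‖ ^ 2 + ‖b k‖ ^ 2 / q k - 2 * (‖c k‖ * ‖b k‖)
        = (q k * ‖c k‖ - ‖b k‖) ^ 2 / q k := by
      have := (hq k).ne'
      field_simp
      ring
    have h3 : 0 ≤ (q k * ‖c k‖ - ‖b k‖) ^ 2 / q k := by have := hq k; positivity
    linarith
  rw [← Finset.sum_div, Finset.sum_add_distrib] at h1
  linarith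

/-- Solvability of an infinite system given by a positive diagonal plus an antihermitian matrix. -/
lemma exists_infinite_solution {ι : Type*} {q : ι → ℝ} (hq : ∀ k, 0 < q k)
    {a : ι → ι → ℂ} (ha : ∀ k l, (starRingEnd ℂ) (a k l) = -a l k)
    (has : ∀ k, Summable fun l => ‖a k l‖ / √(q l)) {b : ι → ℂ}
    (hb : Summable fun k => ‖b k‖ ^ 2 / q k) :
    ∃ c : ι → ℂ, (∃ C, ∀ k, √(q k) * ‖c k‖ ≤ C) ∧ ∀ k, q k * c k + ∑' l, a k l * c l = b k := by
  classical
  set C := √(∑' k, ‖b k‖ ^ 2 / q k) with hC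
  have hfin (F : Finset ι) : ∃ c : ι → ℂ, (∀ k, √(q k) * ‖c k‖ ≤ C) ∧
      ∀ k ∈ F, q k * c k + ∑' l, a k l * c l = b k := by
    obtain ⟨c, hc, hcb⟩ := exists_finite_solution (ι := F) (q := fun k => q k) (fun k => hq k)
      (a := fun k l => a k l) (fun k l => ha k l) (fun k => b k)
    refine ⟨fun k => if hk : k ∈ F then c ⟨k, hk⟩ else 0, fun k => ?_, fun k hk => ?_⟩
    · by_cases hk : k ∈ F
      · simp only [hk, dite_true]
        rw [hC]
        refine Real.le_sqrt_of_sq_le ?_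
        rw [mul_pow, Real.sq_sqrt (hq k).le]
        calc q k * ‖c ⟨k, hk⟩‖ ^ 2 ≤ ∑ k : F, q k * ‖c k‖ ^ 2 :=
              Finset.single_le_sum (f := fun k : F => q k * ‖c k‖ ^ 2)
                (fun k _ => by have := hq k; positivity) (Finset.mem_univ (⟨k, hk⟩ : F))
          _ ≤ _ := hcb
          _ = ∑ k ∈ F, ‖b k‖ ^ 2 / q k := Finset.sum_coe_sort F fun k => ‖b k‖ ^ 2 / q k
          _ ≤ _ := hb.sum_le_tsum _ fun k _ => by have := hq k; positivity
      · simp only [hk, dite_false, norm_zero, mul_zero]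
        exact Real.sqrt_nonneg _
    · simp only [hk, dite_true]
      rw [← hc ⟨k, hk⟩, tsum_eq_sum (s := F) fun l hl => by simp [hl], ← Finset.sum_coe_sort F]
      simp
  choose c hcC hc using hfin
  let U : Ultrafilter (Finset ι) := Ultrafilter.of atTop
  have hlim (k : ι) : ∃ w : ℂ, Tendsto (fun F => c F k) U (𝓝 w) := by
    obtain ⟨w, -, hw⟩ := (isCompact_closedBall (0:ℂ) (C / √(q k))).ultrafilter_le_nhds'
      (U.map fun F => c F k) (Ultrafilter.mem_map.2 (Filter.mem_of_superset univ_mem fun F _ => by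
        have := hcC F k
        rw [mem_preimage, mem_closedBall_zero_iff, le_div_iff₀ (Real.sqrt_pos.2 (hq k))]
        linarith))
    exact ⟨w, hw⟩
  choose d hd using hlim
  refine ⟨d, ⟨C, fun k => le_of_tendsto ((hd k).norm.const_mul _)
    (Eventually.of_forall fun F => hcC F k)⟩, fun k => ?_⟩
  refine tendsto_nhds_unique (f := fun F => q k * c F k + ∑' l, a k l * c F l) (l := U) ?_ ?_
  · refine ((hd k).const_mul _).add (tendsto_tsum_of_dominated_convergence
      ((has k).mul_right C) (fun l => (hd l).const_mul _) (Eventually.of_forall fun F l => ?_))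
    rw [norm_mul, div_mul_eq_mul_div, mul_div_assoc]
    gcongr
    rw [le_div_iff₀ (Real.sqrt_pos.2 (hq l))]
    linarith [hcC F l]
  · refine tendsto_const_nhds.congr' ?_
    have : ∀ᶠ F : Finset ι in U, {k} ≤ F :=
      (eventually_ge_atTop {k}).filter_mono (Ultrafilter.of_le atTop)
    filter_upwards [this] with F hF
    exact (hc F k (Finset.singleton_subset_iff.1 hF)).symm

lemma one_add_norm_le_mul {N : ℕ} (k l : Fin N → ℤ) : 1 + ‖k‖ ≤ (1 + ‖k - l‖) * (1 + ‖l‖) := by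
  have h1 : ‖k‖ ≤ ‖k - l‖ + ‖l‖ := by simpa using norm_add_le (k - l) l
  nlinarith [norm_nonneg (k - l), norm_nonneg l]

/-- Regularity of solutions of a lattice system with rapidly decaying first-order coupling. -/
lemma rapidDecay_of_system {N : ℕ} {q : (Fin N → ℤ) → ℝ} {q₀ : ℝ} (hq₀ : 0 < q₀)
    (hq : ∀ k, q₀ * (1 + ‖k‖) ^ 2 ≤ q k) {v b c : (Fin N → ℤ) → ℂ} (hv : RapidDecay v)
    {a : (Fin N → ℤ) → (Fin N → ℤ) → ℂ} (ha : ∀ k l, ‖a k l‖ ≤ ‖v (k - l)‖ * (1 + ‖l‖))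
    (hb : RapidDecay b) (hcC : ∃ C, ∀ k, √(q k) * ‖c k‖ ≤ C)
    (hc : ∀ k, q k * c k + ∑' l, a k l * c l = b k) : RapidDecay c := by
  have hstep (n : ℕ) : ∃ C, ∀ k, (1 + ‖k‖) ^ (n + 1) * ‖c k‖ ≤ C := by
    induction n with
    | zero =>
      obtain ⟨C, hC⟩ := hcC
      refine ⟨C / √q₀, fun k => ?_⟩
      rw [le_div_iff₀ (Real.sqrt_pos.2 hq₀)]
      refine le_trans ?_ (hC k)
      have : √q₀ * (1 + ‖k‖) ≤ √(q k) := by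
        refine Real.le_sqrt_of_sq_le ?_
        rw [mul_pow, Real.sq_sqrt hq₀.le]
        exact hq k
      calc (1 + ‖k‖) ^ (0 + 1) * ‖c k‖ * √q₀ = √q₀ * (1 + ‖k‖) * ‖c k‖ := by ring
        _ ≤ _ := by gcongr
    | succ n ih =>
      obtain ⟨C, hC⟩ := ih
      obtain ⟨B, hB⟩ := hb n
      have hC0 : 0 ≤ C := le_trans (by positivity) (hC 0)
      set S := ∑' l, (1 + ‖l‖) ^ n * ‖v l‖
      have hsum (k : Fin N → ℤ) : (1 + ‖k‖) ^ n * ‖∑' l, a k l * c l‖ ≤ C * S := by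
        have hS : HasSum (fun l => C * ((1 + ‖k - l‖) ^ n * ‖v (k - l)‖)) (C * S) :=
          (((Equiv.subLeft k).hasSum_iff).2 (hv.summable_pow_mul_norm n).hasSum).mul_left C
        have hle (l : Fin N → ℤ) : (1 + ‖k‖) ^ n * ‖a k l * c l‖
            ≤ C * ((1 + ‖k - l‖) ^ n * ‖v (k - l)‖) := by
          calc (1 + ‖k‖) ^ n * ‖a k l * c l‖
              ≤ ((1 + ‖k - l‖) * (1 + ‖l‖)) ^ n * (‖v (k - l)‖ * (1 + ‖l‖) * ‖c l‖) := by
                rw [norm_mul]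
                gcongr
                · exact one_add_norm_le_mul k l
                · exact ha k l
            _ = (1 + ‖l‖) ^ (n + 1) * ‖c l‖ * ((1 + ‖k - l‖) ^ n * ‖v (k - l)‖) := by
                rw [mul_pow]; ring
            _ ≤ _ := by gcongr; exact hC l
        have := tsum_of_norm_bounded (f := fun l => ((1 + ‖k‖) ^ n : ℝ) • (a k l * c l)) hS
          fun l => by
            rw [norm_smul, Real.norm_of_nonneg (by positivity)]
            exact hle l
        rwa [tsum_const_smul'', norm_smul, Real.norm_of_nonneg (by positivity)] at this
      refine ⟨(B + C * S) / q₀, fun k => ?_⟩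
      rw [le_div_iff₀ hq₀]
      have h1 : q k * ‖c k‖ ≤ ‖b k‖ + ‖∑' l, a k l * c l‖ := by
        have h2 : (q k : ℂ) * c k = b k - ∑' l, a k l * c l := by rw [← hc k]; ring
        have h3 := norm_sub_le (b k) (∑' l, a k l * c l)
        rw [← h2, norm_mul, Complex.norm_real,
          Real.norm_of_nonneg (le_trans (by positivity) (hq k))] at h3
        exact h3
      calc (1 + ‖k‖) ^ (n + 1 + 1) * ‖c k‖ * q₀
          = (1 + ‖k‖) ^ n * (q₀ * (1 + ‖k‖) ^ 2 * ‖c k‖) := by ring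
        _ ≤ (1 + ‖k‖) ^ n * (q k * ‖c k‖) := by gcongr; exact hq k
        _ ≤ (1 + ‖k‖) ^ n * (‖b k‖ + ‖∑' l, a k l * c l‖) := by gcongr
        _ ≤ B + C * S := by rw [mul_add]; exact add_le_add (hB k) (hsum k)
  intro n
  obtain ⟨C, hC⟩ := hstep n
  refine ⟨C, fun k => le_trans ?_ (hC k)⟩
  gcongr
  · linarith [norm_nonneg k]
  · omega

/-- Solvability, with rapid decay, of a lattice system with elliptic diagonal and antihermitian
first-order coupling. -/
lemma exists_rapidDecay_solution {N : ℕ} {q : (Fin N → ℤ) → ℝ} {q₀ : ℝ} (hq₀ : 0 < q₀)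
    (hq : ∀ k, q₀ * (1 + ‖k‖) ^ 2 ≤ q k) {v b : (Fin N → ℤ) → ℂ} (hv : RapidDecay v)
    {a : (Fin N → ℤ) → (Fin N → ℤ) → ℂ} (haa : ∀ k l, (starRingEnd ℂ) (a k l) = -a l k)
    (ha : ∀ k l, ‖a k l‖ ≤ ‖v (k - l)‖ * (1 + ‖l‖)) (hb : RapidDecay b) :
    ∃ c, RapidDecay c ∧ ∀ k, q k * c k + ∑' l, a k l * c l = b k := by
  have hq0 (k : Fin N → ℤ) : 0 < q k := lt_of_lt_of_le (by positivity) (hq k)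
  obtain ⟨B, hB⟩ := hb 0
  obtain ⟨c, hcC, hc⟩ := exists_infinite_solution hq0 haa (fun k => by
      refine Summable.of_nonneg_of_le (fun l => by positivity) (fun l => ?_)
        ((((Equiv.subLeft k).summable_iff).2 hv.summable_norm).div_const √q₀)
      have h1 : √q₀ * (1 + ‖l‖) ≤ √(q l) := by
        refine Real.le_sqrt_of_sq_le ?_
        rw [mul_pow, Real.sq_sqrt hq₀.le]
        exact hq l
      have h2 := Real.sqrt_pos.2 hq₀
      rw [div_le_div_iff₀ (Real.sqrt_pos.2 (hq0 l)) h2]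
      calc ‖a k l‖ * √q₀ ≤ ‖v (k - l)‖ * (1 + ‖l‖) * √q₀ := by gcongr; exact ha k l
        _ = ‖v (k - l)‖ * (√q₀ * (1 + ‖l‖)) := by ring
        _ ≤ ‖v (k - l)‖ * √(q l) := by gcongr) (b := b) (by
      refine Summable.of_nonneg_of_le (fun k => by have := hq0 k; positivity) (fun k => ?_)
        (hb.summable_norm.mul_left (B / q₀))
      have h1 : q₀ ≤ q k := by
        refine le_trans ?_ (hq k)
        exact le_mul_of_one_le_right hq₀.le (one_le_pow₀ (by linarith [norm_nonneg k]))
      have h2 : ‖b k‖ ≤ B := by simpa using hB k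
      have h3 : 0 ≤ B := (norm_nonneg _).trans h2
      rw [div_mul_eq_mul_div, sq]
      gcongr)
  exact ⟨c, rapidDecay_of_system hq₀ hq hv ha hb hcC hc, hc⟩

/-- The phase `2 π k·z / h` as a linear functional of `z`. -/
def phase {N : ℕ} (h : ℝ) (k : Fin N → ℤ) : (Fin N → ℝ) →L[ℝ] ℝ :=
  ∑ i, (2 * Real.pi / h * k i) • ContinuousLinearMap.proj i

/-- The Fourier mode `exp(2 π i k·z / h)`. -/
def fmode {N : ℕ} (h : ℝ) (k : Fin N → ℤ) (z : Fin N → ℝ) : ℂ :=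
  Complex.exp (phase h k z * Complex.I)

/-- The Fourier coefficient of an `h`-periodic function over its period cell. -/
def fcoef {N : ℕ} (h : ℝ) (G : (Fin N → ℝ) → ℂ) (k : Fin N → ℤ) : ℂ :=
  ((h ^ N : ℝ) : ℂ)⁻¹ * ∫ z in Icc (0 : Fin N → ℝ) (fun _ => h), fmode h (-k) z * G z

lemma phase_apply {N : ℕ} (h : ℝ) (k : Fin N → ℤ) (z : Fin N → ℝ) :
    phase h k z = ∑ i, 2 * Real.pi / h * k i * z i := by
  simp [phase]

lemma phase_single {N : ℕ} (h : ℝ) (k : Fin N → ℤ) (i : Fin N) (w : ℝ) :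
    phase h k (Pi.single i w) = 2 * Real.pi / h * k i * w := by
  rw [phase_apply, Finset.sum_eq_single i] <;> simp +contextual

lemma fmode_add {N : ℕ} (h : ℝ) (k l : Fin N → ℤ) (z : Fin N → ℝ) :
    fmode h (k + l) z = fmode h k z * fmode h l z := by
  rw [fmode, fmode, fmode, ← Complex.exp_add, ← add_mul, ← Complex.ofReal_add]
  congr 3
  simp only [phase_apply, ← Finset.sum_add_distrib, Pi.add_apply, Int.cast_add]
  exact Finset.sum_congr rfl fun i _ => by ring

lemma fmode_zero {N : ℕ} (h : ℝ) (z : Fin N → ℝ) : fmode h 0 z = 1 := by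
  simp [fmode, phase_apply]

lemma norm_fmode {N : ℕ} (h : ℝ) (k : Fin N → ℤ) (z : Fin N → ℝ) : ‖fmode h k z‖ = 1 :=
  Complex.norm_exp_ofReal_mul_I _

lemma fmode_add_single {N : ℕ} {h : ℝ} (hh : 0 < h) (k : Fin N → ℤ) (z : Fin N → ℝ) (i : Fin N) :
    fmode h k (z + Pi.single i h) = fmode h k z := by
  rw [fmode, map_add, phase_single, Complex.ofReal_add, add_mul, Complex.exp_add, fmode]
  have : ((2 * Real.pi / h * k i * h : ℝ) : ℂ) * Complex.I = k i * (2 * Real.pi * Complex.I) := by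
    have : (h : ℂ) ≠ 0 := by exact_mod_cast hh.ne'
    push_cast
    field_simp
  rw [this, Complex.exp_int_mul_two_pi_mul_I, mul_one]

lemma hasFDerivAt_fmode {N : ℕ} (h : ℝ) (k : Fin N → ℤ) (z : Fin N → ℝ) :
    HasFDerivAt (fmode h k)
      ((fmode h k z * Complex.I) • Complex.ofRealCLM.comp (phase h k)) z := by
  have h1 : HasFDerivAt (fun z => ((phase h k z : ℝ) : ℂ)) (Complex.ofRealCLM.comp (phase h k)) z :=
    (Complex.ofRealCLM.comp (phase h k)).hasFDerivAt
  have h2 := (h1.mul_const Complex.I).cexp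
  refine h2.congr_fderiv ?_
  rw [smul_smul, fmode]

lemma continuous_fmode {N : ℕ} (h : ℝ) (k : Fin N → ℤ) : Continuous (fmode h k) :=
  continuous_iff_continuousAt.2 fun z => (hasFDerivAt_fmode h k z).continuousAt

lemma integrable_fmode_mul {N : ℕ} (h : ℝ) {G : (Fin N → ℝ) → ℂ} (hG : Continuous G)
    (k : Fin N → ℤ) :
    IntegrableOn (fun z => fmode h k z * G z) (Icc (0 : Fin N → ℝ) fun _ => h) :=
  ((continuous_fmode h k).mul hG).continuousOn.integrableOn_compact isCompact_Icc

lemma fcoef_sub {N : ℕ} (h : ℝ) {G H : (Fin N → ℝ) → ℂ} (hG : Continuous G) (hH : Continuous H)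
    (k : Fin N → ℤ) : fcoef h (fun z => G z - H z) k = fcoef h G k - fcoef h H k := by
  simp only [fcoef, mul_sub]
  rw [integral_sub (integrable_fmode_mul h hG _) (integrable_fmode_mul h hH _), mul_sub]

lemma fcoef_sum {N : ℕ} (h : ℝ) {ι : Type*} (s : Finset ι) {G : ι → (Fin N → ℝ) → ℂ}
    (hG : ∀ i, Continuous (G i)) (k : Fin N → ℤ) :
    fcoef h (fun z => ∑ i ∈ s, G i z) k = ∑ i ∈ s, fcoef h (G i) k := by
  simp only [fcoef, Finset.mul_sum]
  rw [integral_finsetSum _ fun i _ => integrable_fmode_mul h (hG i) _, Finset.mul_sum]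

lemma volume_real_cell {N : ℕ} {h : ℝ} (hh : 0 < h) :
    volume.real (Icc (0 : Fin N → ℝ) fun _ => h) = h ^ N := by
  exact (Real.volume_Icc_pi_toReal (a := fun _ => 0) fun _ => hh.le).trans (by simp)

lemma norm_fcoef_le {N : ℕ} {h : ℝ} (hh : 0 < h) {G : (Fin N → ℝ) → ℂ} {C : ℝ}
    (hC : ∀ z, ‖G z‖ ≤ C) (k : Fin N → ℤ) : ‖fcoef h G k‖ ≤ C := by
  have h1 : ‖∫ z in Icc (0 : Fin N → ℝ) (fun _ => h), fmode h (-k) z * G z‖ ≤ C * h ^ N := by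
    rw [← volume_real_cell hh]
    refine norm_setIntegral_le_of_norm_le_const isCompact_Icc.measure_lt_top fun z _ => ?_
    rw [norm_mul, norm_fmode, one_mul]
    exact hC z
  rw [fcoef, norm_mul, norm_inv, Complex.norm_real, Real.norm_of_nonneg (by positivity),
    inv_mul_le_iff₀ (by positivity)]
  linarith

/-- The integral of a partial derivative of a periodic function over the cell vanishes. -/
lemma integral_fderiv_single_eq_zero {m : ℕ} {h : ℝ} (hh : 0 < h) {G : (Fin (m + 1) → ℝ) → ℂ}
    (hG : ContDiff ℝ 1 G) (hp : ∀ z j, G (z + Pi.single j h) = G z) (i : Fin (m + 1)) :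
    ∫ z in Icc (0 : Fin (m + 1) → ℝ) (fun _ => h), fderiv ℝ G z (Pi.single i 1) = 0 := by
  have hd := hG.differentiable one_ne_zero
  have key := integral_divergence_of_hasFDerivAt_off_countable (0 : Fin (m + 1) → ℝ)
    (fun _ => h) (fun _ => hh.le) (fun z j => if j = i then G z else 0)
    (fun z => ContinuousLinearMap.pi fun j => if j = i then fderiv ℝ G z else 0) ∅
    countable_empty
    (continuous_pi fun j => by
      by_cases hj : j = i
      · simpa [hj] using hG.continuous
      · simpa [hj] using continuous_const).continuousOn
    (fun z _ => hasFDerivAt_pi.2 fun j => by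
      by_cases hj : j = i
      · simpa [hj] using (hd z).hasFDerivAt
      · simpa [hj] using hasFDerivAt_const (0:ℂ) z)
  have hsum (z : Fin (m + 1) → ℝ) : ∑ j, (ContinuousLinearMap.pi fun j =>
      if j = i then fderiv ℝ G z else 0) (Pi.single j 1) j = fderiv ℝ G z (Pi.single i 1) := by
    rw [Finset.sum_eq_single i]
    · simp
    · intro j _ hj
      simp [hj]
    · simp
  simp only [hsum] at key
  rw [key (((hG.continuous_fderiv one_ne_zero).clm_apply
    continuous_const).continuousOn.integrableOn_compact isCompact_Icc)]
  refine Finset.sum_eq_zero fun j _ => ?_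
  by_cases hj : j = i
  · simp only [hj, if_true, Pi.zero_apply, sub_eq_zero]
    congr 1
    ext z
    rw [← hp (i.insertNth 0 z) i]
    congr 1
    ext l
    refine Fin.succAboveCases i ?_ (fun l => ?_) l
    · simp
    · simp [Fin.succAbove_ne]
  · simp [hj]

lemma fcoef_fderiv {m : ℕ} {h : ℝ} (hh : 0 < h) {G : (Fin (m + 1) → ℝ) → ℂ}
    (hG : ContDiff ℝ 1 G) (hp : ∀ z j, G (z + Pi.single j h) = G z) (i : Fin (m + 1))
    (k : Fin (m + 1) → ℤ) :
    fcoef h (fun z => fderiv ℝ G z (Pi.single i 1)) k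
      = 2 * Real.pi / h * Complex.I * k i * fcoef h G k := by
  have hd := hG.differentiable one_ne_zero
  have hder (z : Fin (m + 1) → ℝ) := (hasFDerivAt_fmode h (-k) z).mul (hd z).hasFDerivAt
  have hm : ContDiff ℝ 1 (fmode (N := m + 1) h (-k)) := by
    unfold fmode
    exact ((Complex.ofRealCLM.contDiff.comp (phase h (-k)).contDiff).mul contDiff_const).cexp
  have h0 := integral_fderiv_single_eq_zero hh (hm.mul hG)
    (fun z j => by rw [fmode_add_single hh, hp]) i
  have h1 (z : Fin (m + 1) → ℝ) : fderiv ℝ (fun z => fmode h (-k) z * G z) z (Pi.single i 1)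
      = fmode h (-k) z * fderiv ℝ G z (Pi.single i 1)
        - 2 * Real.pi / h * Complex.I * k i * (fmode h (-k) z * G z) := by
    change fderiv ℝ (fmode h (-k) * G) z (Pi.single i 1) = _
    rw [(hder z).fderiv]
    simp only [add_apply, smul_apply,
      ContinuousLinearMap.comp_apply, phase_single, smul_eq_mul, Complex.ofRealCLM_apply]
    push_cast [Pi.neg_apply]
    ring
  simp only [h1] at h0
  rw [integral_sub (integrable_fmode_mul h
    ((hG.continuous_fderiv one_ne_zero).clm_apply continuous_const) _)
    ((integrable_fmode_mul h hG.continuous _).const_mul _), sub_eq_zero,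
    integral_const_mul] at h0
  rw [fcoef, fcoef, h0]
  ring

lemma fcoef_one {m : ℕ} {h : ℝ} (hh : 0 < h) (k : Fin (m + 1) → ℤ) :
    fcoef h (fun _ => 1) k = if k = 0 then 1 else 0 := by
  split_ifs with hk
  · subst hk
    simp only [fcoef, neg_zero, fmode_zero, mul_one, setIntegral_const, volume_real_cell hh]
    have : ((h ^ (m + 1) : ℝ) : ℂ) ≠ 0 := by
      rw [Complex.ofReal_ne_zero]
      positivity
    rw [Complex.real_smul, mul_one, inv_mul_cancel₀ this]
  · obtain ⟨i, hi⟩ := Function.ne_iff.1 hk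
    have h1 := fcoef_fderiv hh (G := fun _ => (1:ℂ)) contDiff_const (fun _ _ => rfl) i k
    have h2 : fcoef h (fun z : Fin (m + 1) → ℝ =>
        fderiv ℝ (fun _ => (1:ℂ)) z (Pi.single i 1)) k = 0 := by simp [fcoef]
    rw [h2, eq_comm, mul_eq_zero] at h1
    refine h1.resolve_left ?_
    have : (h : ℂ) ≠ 0 := by exact_mod_cast hh.ne'
    have : (Real.pi : ℂ) ≠ 0 := by exact_mod_cast Real.pi_ne_zero
    have : (k i : ℂ) ≠ 0 := by exact_mod_cast hi
    simp [*]

lemma rapidDecay_fcoef {m : ℕ} {h : ℝ} (hh : 0 < h) {G : (Fin (m + 1) → ℝ) → ℂ}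
    (hG : ContDiff ℝ (⊤ : ℕ∞) G) (hp : ∀ z j, G (z + Pi.single j h) = G z) :
    RapidDecay (fcoef h G) := by
  intro n
  induction n generalizing G with
  | zero =>
    obtain ⟨C, -, hC⟩ := exists_bound_of_periodic hh hG.continuous hp
    exact ⟨C, fun k => by simpa using norm_fcoef_le hh hC k⟩
  | succ n ih =>
    have hG1 : ContDiff ℝ 1 G := hG.of_le (by exact_mod_cast le_top)
    have hD (i : Fin (m + 1)) := ih (G := fun z => fderiv ℝ G z (Pi.single i 1))
      ((hG.fderiv_right (m := (⊤ : ℕ∞)) (by simp)).clm_apply contDiff_const) (fun z j => by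
        have : (fun w => G (w + Pi.single j h)) = G := funext fun w => hp w j
        rw [← fderiv_comp_add_right, this])
    choose C hC using hD
    obtain ⟨C₀, hC₀⟩ := ih hG hp
    refine ⟨C₀ + h / (2 * Real.pi) * ∑ i, C i, fun k => ?_⟩
    obtain ⟨i, hi⟩ : ∃ i, ‖k‖ = ‖k i‖ := by
      obtain ⟨i, -, hi⟩ := Finset.exists_mem_eq_sup Finset.univ Finset.univ_nonempty
        fun i => ‖k i‖₊
      exact ⟨i, by rw [Pi.norm_def, hi, coe_nnnorm]⟩
    have h1 : ‖k‖ * ‖fcoef h G k‖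
        = h / (2 * Real.pi) * ‖fcoef h (fun z => fderiv ℝ G z (Pi.single i 1)) k‖ := by
      rw [fcoef_fderiv hh hG1 hp, hi, Int.norm_eq_abs]
      simp only [norm_mul, norm_div, Complex.norm_I, Complex.norm_intCast, Complex.norm_real,
        Complex.norm_ofNat, Real.norm_of_nonneg hh.le, Real.norm_of_nonneg Real.pi_pos.le]
      have := Real.pi_ne_zero
      field_simp
    have h2 : (1 + ‖k‖) ^ n * ‖fcoef h (fun z => fderiv ℝ G z (Pi.single i 1)) k‖ ≤ ∑ i, C i :=
      (hC i k).trans (Finset.single_le_sum (f := C)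
        (fun j _ => le_trans (by positivity) (hC j 0)) (Finset.mem_univ i))
    calc (1 + ‖k‖) ^ (n + 1) * ‖fcoef h G k‖
        = (1 + ‖k‖) ^ n * ‖fcoef h G k‖ + (1 + ‖k‖) ^ n * (‖k‖ * ‖fcoef h G k‖) := by ring
      _ = (1 + ‖k‖) ^ n * ‖fcoef h G k‖ + h / (2 * Real.pi) * ((1 + ‖k‖) ^ n *
            ‖fcoef h (fun z => fderiv ℝ G z (Pi.single i 1)) k‖) := by rw [h1]; ring
      _ ≤ _ := by
        have := Real.pi_pos
        gcongr
        exact hC₀ k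

open scoped Pointwise in
/-- A continuous periodic function is determined by its Fourier coefficients. -/
lemma eq_zero_of_fcoef_eq_zero {N : ℕ} {h : ℝ} (hh : 0 < h) {G : (Fin N → ℝ) → ℂ}
    (hG : Continuous G) (hp : ∀ z j, G (z + Pi.single j h) = G z) (h0 : ∀ k, fcoef h G k = 0)
    (z : Fin N → ℝ) : G z = 0 := by
  let π : (Fin N → ℝ) → UnitAddTorus (Fin N) := Pi.map fun _ x => (x : UnitAddCircle)
  have hπ : IsOpenQuotientMap π :=
    IsOpenQuotientMap.piMap fun _ => QuotientAddGroup.isOpenQuotientMap_mk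
  let Gt : UnitAddTorus (Fin N) → ℂ := fun y => G (h • Function.surjInv hπ.surjective y)
  have hGt (x : Fin N → ℝ) : Gt (π x) = G (h • x) := by
    set x' := Function.surjInv hπ.surjective (π x) with hx'
    have h1 : π x' = π x := Function.surjInv_eq _ _
    have h2 (j : Fin N) : ∃ n : ℤ, (n : ℝ) = x' j - x j := by
      have := congrFun h1 j
      simp only [π, Pi.map_apply] at this
      have := QuotientAddGroup.eq_iff_sub_mem.1 this
      obtain ⟨n, hn⟩ := AddSubgroup.mem_zmultiples_iff.1 this
      exact ⟨n, by simpa using hn⟩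
    choose n hn using h2
    have h3 := eq_add_sum_zsmul_of_periodic Finset.univ (fun z j _ => hp z j) n (h • x)
    rw [← h3]
    change G (h • x') = _
    congr 1
    ext j
    simp only [Pi.smul_apply, smul_eq_mul, Pi.add_apply, Finset.sum_apply, Pi.single_apply,
      Finset.sum_ite_eq, Finset.mem_univ, if_true, hn]
    ring
  have hGc : Continuous Gt := by
    rw [hπ.isQuotientMap.continuous_iff]
    have : Gt ∘ π = fun x => G (h • x) := funext hGt
    rw [this]
    fun_prop
  have hcoef (k : Fin N → ℤ) : UnitAddTorus.mFourierCoeff Gt k = 0 := by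
    rw [UnitAddTorus.mFourierCoeff_eq_integral Gt k 0]
    have h1 (x : Fin N → ℝ) : ((UnitAddTorus.mFourier (-k)) fun i => (x i : UnitAddCircle)) •
        Gt (fun i => (x i : UnitAddCircle)) = fmode h (-k) (h • x) * G (h • x) := by
      rw [smul_eq_mul, ← hGt x]
      congr 1
      simp only [UnitAddTorus.mFourier, ContinuousMap.coe_mk, fourier_coe_apply]
      rw [← Complex.exp_sum, fmode, phase_apply]
      congr 1
      have : (h : ℂ) ≠ 0 := by exact_mod_cast hh.ne'
      push_cast [Pi.neg_apply, Pi.smul_apply, smul_eq_mul]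
      rw [Finset.sum_mul]
      refine Finset.sum_congr rfl fun i _ => ?_
      field_simp
    simp only [h1]
    rw [Measure.setIntegral_comp_smul volume (fun w => fmode h (-k) w * G w) _ hh.ne']
    have hset : h • {x : Fin N → ℝ | ∀ i, x i ∈ Ioc ((0 : Fin N → ℝ) i) ((0 : Fin N → ℝ) i + 1)}
        = univ.pi fun _ => Ioc 0 h := by
      ext w
      rw [mem_smul_set_iff_inv_smul_mem₀ hh.ne']
      simp only [mem_ofPred_eq, Pi.smul_apply, Pi.zero_apply, smul_eq_mul, zero_add, mem_Ioc,
        mem_univ_pi]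
      refine forall_congr' fun i => ?_
      rw [inv_mul_le_iff₀ hh, mul_one, inv_mul_eq_div, div_pos_iff_of_pos_right hh]
    have hae : (univ.pi fun _ => Ioc 0 h) =ᵐ[volume] Icc (0 : Fin N → ℝ) fun _ => h :=
      Measure.univ_pi_Ioc_ae_eq_Icc
    rw [hset, setIntegral_congr_set hae]
    have := h0 k
    rw [fcoef, mul_eq_zero, inv_eq_zero, Complex.ofReal_eq_zero] at this
    rw [this.resolve_left (by positivity), smul_zero]
  have hs := UnitAddTorus.hasSum_mFourier_series_apply_of_summable (f := ⟨Gt, hGc⟩)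
    (by
      change Summable (UnitAddTorus.mFourierCoeff Gt)
      rw [funext hcoef]
      exact summable_zero) (π (h⁻¹ • z))
  simp only [ContinuousMap.coe_mk, hcoef, zero_smul] at hs
  have := hs.unique hasSum_zero
  rwa [hGt, smul_smul, mul_inv_cancel₀ hh.ne', one_smul] at this

/-- The Fourier series with coefficients `c`. -/
def fsum {N : ℕ} (h : ℝ) (c : (Fin N → ℤ) → ℂ) (z : Fin N → ℝ) : ℂ :=
  ∑' k, c k * fmode h k z

lemma summable_mul_fmode {N : ℕ} (h : ℝ) {c : (Fin N → ℤ) → ℂ} (hc : RapidDecay c)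
    (z : Fin N → ℝ) : Summable fun k => c k * fmode h k z :=
  Summable.of_norm (by simpa [norm_fmode] using hc.summable_norm)

lemma fsum_add_single {N : ℕ} {h : ℝ} (hh : 0 < h) (c : (Fin N → ℤ) → ℂ) (z : Fin N → ℝ)
    (i : Fin N) : fsum h c (z + Pi.single i h) = fsum h c z := by
  simp only [fsum, fmode_add_single hh]

lemma norm_phase_le {N : ℕ} (h : ℝ) (k : Fin N → ℤ) :
    ‖phase h k‖ ≤ N * |2 * Real.pi / h| * ‖k‖ := by
  refine ContinuousLinearMap.opNorm_le_bound _ (by positivity) fun z => ?_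
  rw [phase_apply]
  refine (norm_sum_le _ _).trans ((Finset.sum_le_card_nsmul _ _
    (|2 * Real.pi / h| * ‖k‖ * ‖z‖) fun i _ => ?_).trans_eq ?_)
  · rw [norm_mul, norm_mul]
    have h1 := norm_le_pi_norm k i
    rw [Int.norm_eq_abs, ← Real.norm_eq_abs] at h1
    have h2 := norm_le_pi_norm z i
    rw [Real.norm_eq_abs (2 * Real.pi / h)]
    gcongr
  · rw [Finset.card_univ, Fintype.card_fin, nsmul_eq_mul]
    ring

lemma norm_smul_fderiv_fmode_le {N : ℕ} (h : ℝ) (w : ℂ) (k : Fin N → ℤ) (z : Fin N → ℝ) :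
    ‖w • ((fmode h k z * Complex.I) • Complex.ofRealCLM.comp (phase h k))‖
      ≤ N * |2 * Real.pi / h| * ((1 + ‖k‖) ^ 1 * ‖w‖) := by
  rw [norm_smul, norm_smul, norm_mul, norm_fmode, Complex.norm_I, one_mul, one_mul]
  have h1 : ‖Complex.ofRealCLM.comp (phase h k)‖ ≤ N * |2 * Real.pi / h| * ‖k‖ := by
    refine (ContinuousLinearMap.opNorm_comp_le _ _).trans ?_
    rw [Complex.ofRealCLM_norm, one_mul]
    exact norm_phase_le h k
  calc ‖w‖ * ‖Complex.ofRealCLM.comp (phase h k)‖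
      ≤ ‖w‖ * (N * |2 * Real.pi / h| * ‖k‖) := by gcongr
    _ ≤ ‖w‖ * (N * |2 * Real.pi / h| * (1 + ‖k‖)) := by gcongr; linarith
    _ = _ := by ring

lemma hasFDerivAt_fsum {N : ℕ} (h : ℝ) {c : (Fin N → ℤ) → ℂ} (hc : RapidDecay c)
    (z : Fin N → ℝ) : HasFDerivAt (fsum h c) (∑' k, c k •
      ((fmode h k z * Complex.I) • Complex.ofRealCLM.comp (phase h k))) z :=
  hasFDerivAt_tsum ((hc.summable_pow_mul_norm 1).mul_left _)
    (fun k z => (hasFDerivAt_fmode h k z).const_mul _)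
    (fun k z => norm_smul_fderiv_fmode_le h (c k) k z) (summable_mul_fmode h hc 0) z

lemma summable_fderiv_fmode {N : ℕ} (h : ℝ) {c : (Fin N → ℤ) → ℂ} (hc : RapidDecay c)
    (z : Fin N → ℝ) : Summable fun k => c k •
      ((fmode h k z * Complex.I) • Complex.ofRealCLM.comp (phase h k)) :=
  Summable.of_norm_bounded ((hc.summable_pow_mul_norm 1).mul_left _)
    fun k => norm_smul_fderiv_fmode_le h (c k) k z

lemma fderiv_fsum_single {N : ℕ} (h : ℝ) {c : (Fin N → ℤ) → ℂ} (hc : RapidDecay c)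
    (z : Fin N → ℝ) (i : Fin N) : fderiv ℝ (fsum h c) z (Pi.single i 1)
      = fsum h (fun k => 2 * Real.pi / h * Complex.I * k i * c k) z := by
  rw [(hasFDerivAt_fsum h hc z).fderiv]
  have := (ContinuousLinearMap.apply ℝ ℂ (Pi.single i (1:ℝ) : Fin N → ℝ)).map_tsum
    (summable_fderiv_fmode h hc z)
  rw [ContinuousLinearMap.apply_apply] at this
  rw [this, fsum]
  refine tsum_congr fun k => ?_
  simp only [ContinuousLinearMap.apply_apply, smul_apply, ContinuousLinearMap.comp_apply,
    phase_single, smul_eq_mul, Complex.ofRealCLM_apply]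
  push_cast
  ring

lemma contDiff_fsum {N : ℕ} (h : ℝ) {c : (Fin N → ℤ) → ℂ} (hc : RapidDecay c) :
    ContDiff ℝ (⊤ : ℕ∞) (fsum h c) := by
  rw [contDiff_infty]
  intro n
  induction n generalizing c with
  | zero =>
    exact contDiff_zero.2 (continuous_iff_continuousAt.2 fun z =>
      (hasFDerivAt_fsum h hc z).continuousAt)
  | succ n ih =>
    rw [Nat.cast_succ, contDiff_succ_iff_fderiv_apply]
    refine ⟨fun z => (hasFDerivAt_fsum h hc z).differentiableAt, by simp, fun y => ?_⟩
    have h1 (z : Fin N → ℝ) : fderiv ℝ (fsum h c) z y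
        = ∑ i, y i • fsum h (fun k => 2 * Real.pi / h * Complex.I * k i * c k) z := by
      conv_lhs => rw [← Finset.univ_sum_single y, map_sum]
      refine Finset.sum_congr rfl fun i _ => ?_
      rw [← fderiv_fsum_single h hc, ← map_smul, ← Pi.single_smul, smul_eq_mul, mul_one]
    simp only [h1]
    exact ContDiff.sum fun i _ => (ih (hc.mul_coord _ i)).const_smul (y i)

lemma continuous_fsum {N : ℕ} (h : ℝ) {c : (Fin N → ℤ) → ℂ} (hc : RapidDecay c) :
    Continuous (fsum h c) :=
  (contDiff_fsum h hc).continuous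

/-- Fourier coefficients of a product are given by convolution. -/
lemma hasSum_fcoef_mul_fsum {N : ℕ} {h : ℝ} (hh : 0 < h) {G : (Fin N → ℝ) → ℂ}
    (hG : Continuous G) (hp : ∀ z j, G (z + Pi.single j h) = G z) {c : (Fin N → ℤ) → ℂ}
    (hc : RapidDecay c) (k : Fin N → ℤ) :
    HasSum (fun l => c l * fcoef h G (k - l)) (fcoef h (fun z => G z * fsum h c z) k) := by
  obtain ⟨C, hC0, hC⟩ := exists_bound_of_periodic hh hG hp
  have key := hasSum_integral_of_summable_integral_norm
    (μ := volume.restrict (Icc (0 : Fin N → ℝ) fun _ => h))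
    (F := fun l z => c l * (fmode h (-(k - l)) z * G z))
    (fun l => (integrable_fmode_mul h hG _).const_mul _)
    (by
      refine Summable.of_nonneg_of_le (fun l => integral_nonneg fun z => norm_nonneg _)
        (fun l => ?_) (hc.summable_norm.mul_right (C * h ^ N))
      have h1 : ‖∫ z in Icc (0 : Fin N → ℝ) (fun _ => h),
          ‖c l * (fmode h (-(k - l)) z * G z)‖‖ ≤ ‖c l‖ * C * h ^ N := by
        rw [← volume_real_cell hh]
        refine norm_setIntegral_le_of_norm_le_const isCompact_Icc.measure_lt_top fun z _ => ?_
        rw [norm_norm, norm_mul, norm_mul, norm_fmode, one_mul]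
        gcongr
        exact hC z
      rw [← mul_assoc]
      exact (le_abs_self _).trans h1)
  have h2 (z : Fin N → ℝ) : ∑' l, c l * (fmode h (-(k - l)) z * G z)
      = fmode h (-k) z * (G z * fsum h c z) := by
    rw [fsum, ← mul_assoc, ← tsum_mul_left]
    refine tsum_congr fun l => ?_
    rw [show -(k - l) = -k + l by abel, fmode_add]
    ring
  simp only [h2, integral_const_mul] at key
  have h3 (l : Fin N → ℤ) : c l * fcoef h G (k - l) = ((h ^ N : ℝ) : ℂ)⁻¹ *
      (c l * ∫ z in Icc (0 : Fin N → ℝ) (fun _ => h), fmode h (-(k - l)) z * G z) := by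
    rw [fcoef]
    ring
  simp only [h3]
  exact key.mul_left _

lemma fcoef_fsum {m : ℕ} {h : ℝ} (hh : 0 < h) {c : (Fin (m + 1) → ℤ) → ℂ} (hc : RapidDecay c)
    (k : Fin (m + 1) → ℤ) : fcoef h (fsum h c) k = c k := by
  have h1 := hasSum_fcoef_mul_fsum hh (G := fun _ => 1) continuous_const (fun _ _ => rfl) hc k
  simp only [one_mul] at h1
  change fcoef h (fun z => fsum h c z) k = c k
  rw [← h1.tsum_eq, tsum_eq_single k fun l hl => ?_]
  · simp [fcoef_one hh]
  · rw [fcoef_one hh, if_neg (sub_ne_zero.2 hl.symm), mul_zero]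

lemma conj_fmode {N : ℕ} (h : ℝ) (k : Fin N → ℤ) (z : Fin N → ℝ) :
    (starRingEnd ℂ) (fmode h k z) = fmode h (-k) z := by
  rw [fmode, fmode, ← Complex.exp_conj, map_mul, Complex.conj_ofReal, Complex.conj_I]
  congr 1
  simp [phase_apply]

lemma conj_fcoef_ofReal {N : ℕ} (h : ℝ) (g : (Fin N → ℝ) → ℝ) (k : Fin N → ℤ) :
    (starRingEnd ℂ) (fcoef h (fun z => (g z : ℂ)) k) = fcoef h (fun z => (g z : ℂ)) (-k) := by
  rw [fcoef, fcoef, map_mul, ← integral_conj, map_inv₀, Complex.conj_ofReal]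
  simp only [map_mul, conj_fmode, Complex.conj_ofReal]

lemma fderiv_ofReal_comp {N : ℕ} {g : (Fin N → ℝ) → ℝ} {z : Fin N → ℝ}
    (hg : DifferentiableAt ℝ g z) (i : Fin N) :
    fderiv ℝ (fun z => (g z : ℂ)) z (Pi.single i 1) = (pd i g z : ℂ) := by
  have : HasFDerivAt (fun z => (g z : ℂ)) (Complex.ofRealCLM.comp (fderiv ℝ g z)) z :=
    Complex.ofRealCLM.hasFDerivAt.comp z hg.hasFDerivAt
  rw [this.fderiv]
  rfl

lemma pd_re {N : ℕ} {G : (Fin N → ℝ) → ℂ} {z : Fin N → ℝ}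
    (hG : DifferentiableAt ℝ G z) (i : Fin N) :
    pd i (fun z => (G z).re) z = (fderiv ℝ G z (Pi.single i 1)).re := by
  have : HasFDerivAt (fun z => (G z).re) (Complex.reCLM.comp (fderiv ℝ G z)) z :=
    Complex.reCLM.hasFDerivAt.comp z hG.hasFDerivAt
  rw [pd, this.fderiv]
  rfl

lemma sq_norm_le_sum_sq {N : ℕ} (k : Fin N → ℤ) : ‖k‖ ^ 2 ≤ ∑ i, (k i : ℝ) ^ 2 := by
  have h0 : 0 ≤ ∑ i, (k i : ℝ) ^ 2 := Finset.sum_nonneg fun i _ => sq_nonneg _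
  rw [← Real.le_sqrt (norm_nonneg _) h0, pi_norm_le_iff_of_nonneg (Real.sqrt_nonneg _)]
  intro i
  rw [Int.norm_eq_abs, Real.le_sqrt (abs_nonneg _) h0, sq_abs]
  exact Finset.single_le_sum (f := fun i => (k i : ℝ) ^ 2) (fun i _ => sq_nonneg _)
    (Finset.mem_univ i)

lemma one_le_norm_of_ne_zero {N : ℕ} {k : Fin N → ℤ} (hk : k ≠ 0) : 1 ≤ ‖k‖ := by
  obtain ⟨i, hi⟩ := Function.ne_iff.1 hk
  refine le_trans ?_ (norm_le_pi_norm k i)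
  rw [Int.norm_eq_abs]
  exact_mod_cast Int.one_le_abs hi

lemma RapidDecay.neg {N : ℕ} {c : (Fin N → ℤ) → ℂ} (hc : RapidDecay c) :
    RapidDecay fun k => -c k := by
  simpa only [RapidDecay, norm_neg] using hc

lemma RapidDecay.sum_norm {N : ℕ} {ι : Type*} (s : Finset ι) {c : ι → (Fin N → ℤ) → ℂ}
    (hc : ∀ i, RapidDecay (c i)) (r : ℝ) :
    RapidDecay fun k => ((r * ∑ i ∈ s, ‖c i k‖ : ℝ) : ℂ) := by
  intro n
  choose C hC using fun i => hc i n
  refine ⟨|r| * ∑ i ∈ s, C i, fun k => ?_⟩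
  have h0 : 0 ≤ ∑ i ∈ s, ‖c i k‖ := Finset.sum_nonneg fun i _ => norm_nonneg _
  rw [Complex.norm_real, norm_mul, Real.norm_eq_abs, Real.norm_of_nonneg h0, mul_left_comm,
    Finset.mul_sum]
  gcongr with i
  exact hC i k

/-- The Fourier coefficients of a divergence-free field are orthogonal to their index. -/
lemma sum_mul_fcoef_eq_zero {m : ℕ} {h : ℝ} (hh : 0 < h)
    {u : (Fin (m + 1) → ℝ) → Fin (m + 1) → ℝ} (hu : ContDiff ℝ (⊤ : ℕ∞) u)
    (hdiv : ∀ z, ∑ i, pd i (fun w => u w i) z = 0)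
    (hp : ∀ z i, u (z + Pi.single i h) = u z) (k : Fin (m + 1) → ℤ) :
    ∑ i, (k i : ℂ) * fcoef h (fun z => (u z i : ℂ)) k = 0 := by
  have hui (i : Fin (m + 1)) : ContDiff ℝ 1 fun z => u z i :=
    (contDiff_pi.1 (hu.of_le (by exact_mod_cast le_top))) i
  have huc (i : Fin (m + 1)) : ContDiff ℝ 1 fun z => (u z i : ℂ) :=
    Complex.ofRealCLM.contDiff.comp (hui i)
  have h1 (i : Fin (m + 1)) := fcoef_fderiv hh (huc i) (fun z j => by rw [hp]) i k
  have h2 := fcoef_sum h Finset.univ (G := fun i z =>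
    fderiv ℝ (fun z => (u z i : ℂ)) z (Pi.single i 1))
    (fun i => ((huc i).continuous_fderiv one_ne_zero).clm_apply continuous_const) k
  have h3 (z : Fin (m + 1) → ℝ) :
      ∑ i, fderiv ℝ (fun z => (u z i : ℂ)) z (Pi.single i 1) = 0 := by
    simp only [fderiv_ofReal_comp ((hui _).differentiable one_ne_zero z)]
    rw [← Complex.ofReal_sum, hdiv, Complex.ofReal_zero]
  simp only [h3, h1] at h2
  have h4 : fcoef h (fun _ : Fin (m + 1) → ℝ => (0 : ℂ)) k = 0 := by simp [fcoef]
  rw [h4] at h2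
  simp only [mul_assoc] at h2
  simp only [← Finset.mul_sum] at h2
  have hh' : (h : ℂ) ≠ 0 := by exact_mod_cast hh.ne'
  have : (Real.pi : ℂ) ≠ 0 := by exact_mod_cast Real.pi_ne_zero
  have h5 : 2 * (Real.pi : ℂ) / h ≠ 0 :=
    div_ne_zero (mul_ne_zero two_ne_zero this) hh'
  rcases mul_eq_zero.1 h2.symm with h6 | h6
  · exact absurd h6 h5
  · exact (mul_eq_zero.1 h6).resolve_left Complex.I_ne_zero

lemma fcoef_zero_eq_zero {N : ℕ} {h : ℝ} {g : (Fin N → ℝ) → ℝ}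
    (hg : ∫ z in univ.pi fun _ : Fin N => Ico (0:ℝ) h, g z = 0) :
    fcoef h (fun z => (g z : ℂ)) 0 = 0 := by
  have hae : (univ.pi fun _ => Ico 0 h) =ᵐ[volume] Icc (0 : Fin N → ℝ) fun _ => h :=
    Measure.univ_pi_Ico_ae_eq_Icc
  rw [setIntegral_congr_set hae] at hg
  simp only [fcoef, neg_zero, fmode_zero, one_mul]
  rw [integral_complex_ofReal, hg]
  simp

/-- Solvability of `Δχ - u·∇χ = g` on the torus for divergence-free `u` and mean-zero `g`. -/
theorem exists_corrector {m : ℕ} {h : ℝ} (hh : 0 < h)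
    {u : (Fin (m + 1) → ℝ) → Fin (m + 1) → ℝ} (hu : ContDiff ℝ (⊤ : ℕ∞) u)
    (hdiv : ∀ z, ∑ i, pd i (fun w => u w i) z = 0)
    (hp : ∀ z i, u (z + Pi.single i h) = u z) {g : (Fin (m + 1) → ℝ) → ℝ}
    (hg : ContDiff ℝ (⊤ : ℕ∞) g) (hgp : ∀ z i, g (z + Pi.single i h) = g z)
    (hg0 : ∫ z in univ.pi fun _ : Fin (m + 1) => Ico (0:ℝ) h, g z = 0) :
    ∃ χ : (Fin (m + 1) → ℝ) → ℝ, ContDiff ℝ (⊤ : ℕ∞) χ ∧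
      (∀ z i, χ (z + Pi.single i h) = χ z) ∧
      ∀ z, lap χ z - ∑ i, u z i * pd i χ z = g z := by
  have hui (i : Fin (m + 1)) : ContDiff ℝ (⊤ : ℕ∞) fun z => (u z i : ℂ) :=
    Complex.ofRealCLM.contDiff.comp (contDiff_pi.1 hu i)
  have hgc : ContDiff ℝ (⊤ : ℕ∞) fun z => (g z : ℂ) := Complex.ofRealCLM.contDiff.comp hg
  set ω : ℝ := 2 * Real.pi / h with hω
  have hω0 : 0 < ω := by have := Real.pi_pos; positivity
  set W : ℂ := 2 * Real.pi / h * Complex.I with hW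
  have hWω : W = ω * Complex.I := by rw [hW, hω]; push_cast; ring
  have hW2 : W * W = -(ω : ℂ) ^ 2 := by
    rw [hWω, mul_mul_mul_comm, Complex.I_mul_I]; ring
  set v : Fin (m + 1) → (Fin (m + 1) → ℤ) → ℂ := fun i => fcoef h fun z => (u z i : ℂ) with hv
  have hvd (i : Fin (m + 1)) : RapidDecay (v i) :=
    rapidDecay_fcoef hh (hui i) fun z j => by rw [hp]
  have hbd : RapidDecay (fcoef h fun z => (g z : ℂ)) :=
    rapidDecay_fcoef hh hgc fun z j => by rw [hgp]
  set q : (Fin (m + 1) → ℤ) → ℝ :=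
    fun k => ω ^ 2 * ∑ i, (k i : ℝ) ^ 2 + if k = 0 then 1 else 0 with hq
  set a : (Fin (m + 1) → ℤ) → (Fin (m + 1) → ℤ) → ℂ :=
    fun k l => ∑ i, W * l i * v i (k - l) with ha
  have hvk (k : Fin (m + 1) → ℤ) : ∑ i, (k i : ℂ) * v i k = 0 :=
    sum_mul_fcoef_eq_zero hh hu hdiv hp k
  have haa (k l : Fin (m + 1) → ℤ) : (starRingEnd ℂ) (a k l) = -a l k := by
    have h1 := hvk (l - k)
    simp only [ha, map_sum, map_mul]
    rw [← Finset.sum_neg_distrib, ← sub_eq_zero, ← Finset.sum_sub_distrib]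
    have h2 : (starRingEnd ℂ) W = -W := by
      rw [hWω, map_mul, Complex.conj_ofReal, Complex.conj_I, mul_neg]
    calc _ = ∑ i, -W * (((l - k) i : ℤ) * v i (l - k)) := by
          refine Finset.sum_congr rfl fun i _ => ?_
          rw [h2, hv, conj_fcoef_ofReal, neg_sub, Pi.sub_apply]
          push_cast
          rw [map_intCast]
          ring
      _ = 0 := by rw [← Finset.mul_sum, h1, mul_zero]
  have ha0 (l : Fin (m + 1) → ℤ) : a 0 l = 0 := by
    have h1 : a l 0 = 0 := by simp [ha]
    have h2 := haa l 0
    rw [h1, map_zero] at h2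
    exact neg_eq_zero.1 h2.symm
  obtain ⟨c, hcd, hc⟩ := exists_rapidDecay_solution (q := q) (q₀ := min (ω ^ 2 / 4) 1)
    (by positivity) (fun k => by
      by_cases hk : k = 0
      · subst hk
        simp [hq]
      · have h1 := one_le_norm_of_ne_zero hk
        have h2 := sq_norm_le_sum_sq k
        simp only [hq, hk, if_false, add_zero]
        calc min (ω ^ 2 / 4) 1 * (1 + ‖k‖) ^ 2 ≤ ω ^ 2 / 4 * (1 + ‖k‖) ^ 2 := by
              gcongr
              exact min_le_left _ _
          _ ≤ ω ^ 2 / 4 * (4 * ‖k‖ ^ 2) := by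
              gcongr
              nlinarith
          _ = ω ^ 2 * ‖k‖ ^ 2 := by ring
          _ ≤ _ := by gcongr)
    (RapidDecay.sum_norm Finset.univ hvd ω) haa (fun k l => by
      have h0 : 0 ≤ ∑ i, ‖v i (k - l)‖ := Finset.sum_nonneg fun i _ => norm_nonneg _
      rw [Complex.norm_real, Real.norm_of_nonneg (by positivity), Finset.mul_sum, Finset.sum_mul]
      refine (norm_sum_le _ _).trans (Finset.sum_le_sum fun i _ => ?_)
      have h1 := norm_le_pi_norm l i
      rw [norm_mul, norm_mul, hWω, norm_mul, Complex.norm_I, mul_one, Complex.norm_real,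
        Real.norm_of_nonneg hω0.le, Complex.norm_intCast, ← Int.norm_eq_abs]
      calc ω * ‖l i‖ * ‖v i (k - l)‖ ≤ ω * (1 + ‖l‖) * ‖v i (k - l)‖ := by
            gcongr
            linarith
        _ = _ := by ring) hbd.neg
  have hc0 : c 0 = 0 := by
    have := hc 0
    simp only [ha0, zero_mul, tsum_zero, add_zero, fcoef_zero_eq_zero hg0, neg_zero] at this
    simpa [hq] using this
  set D : Fin (m + 1) → ((Fin (m + 1) → ℤ) → ℂ) → (Fin (m + 1) → ℤ) → ℂ :=
    fun i c k => W * k i * c k with hD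
  have hDd (i : Fin (m + 1)) : RapidDecay (D i c) := hcd.mul_coord W i
  have hDDd (i : Fin (m + 1)) : RapidDecay (D i (D i c)) := (hDd i).mul_coord W i
  have hres (z : Fin (m + 1) → ℝ) : ∑ i, fsum h (D i (D i c)) z
      - ∑ i, (u z i : ℂ) * fsum h (D i c) z - (g z : ℂ) = 0 := by
    have c1 (i : Fin (m + 1)) : Continuous (fsum h (D i (D i c))) := continuous_fsum h (hDDd i)
    have c2 (i : Fin (m + 1)) : Continuous fun z => (u z i : ℂ) * fsum h (D i c) z :=
      (hui i).continuous.mul (continuous_fsum h (hDd i))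
    have c3 : Continuous fun z => ∑ i, fsum h (D i (D i c)) z :=
      continuous_finsetSum _ fun i _ => c1 i
    have c4 : Continuous fun z => ∑ i, (u z i : ℂ) * fsum h (D i c) z :=
      continuous_finsetSum _ fun i _ => c2 i
    have c5 : Continuous fun z => ∑ i, fsum h (D i (D i c)) z
      - ∑ i, (u z i : ℂ) * fsum h (D i c) z := c3.sub c4
    refine eq_zero_of_fcoef_eq_zero (G := fun z => ∑ i, fsum h (D i (D i c)) z
      - ∑ i, (u z i : ℂ) * fsum h (D i c) z - (g z : ℂ)) hh (c5.sub hgc.continuous)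
      (fun z j => by simp only [fsum_add_single hh, hp, hgp]) (fun k => ?_) z
    rw [fcoef_sub h c5 hgc.continuous, fcoef_sub h c3 c4, fcoef_sum h _ c1,
      fcoef_sum h _ c2]
    have h1 (i : Fin (m + 1)) := hasSum_fcoef_mul_fsum hh (hui i).continuous
      (fun z j => by rw [hp]) (hDd i) k
    have h2 : ∑ i, fcoef h (fun z => (u z i : ℂ) * fsum h (D i c) z) k = ∑' l, a k l * c l := by
      rw [← (hasSum_sum fun i _ => h1 i).tsum_eq]
      refine tsum_congr fun l => ?_
      rw [ha, Finset.sum_mul]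
      exact Finset.sum_congr rfl fun i _ => by simp only [hD, hv]; ring
    have h3 : ∑ i, fcoef h (fsum h (D i (D i c))) k = -((q k : ℂ) * c k) := by
      simp only [fcoef_fsum hh (hDDd _)]
      simp only [hD]
      have h4 (i : Fin (m + 1)) : W * k i * (W * k i * c k) = W * W * c k * (k i : ℂ) ^ 2 := by
        ring
      simp only [h4]
      rw [← Finset.mul_sum, hW2]
      simp only [hq]
      by_cases hk : k = 0
      · simp [hk, hc0]
      · simp only [hk, if_false]
        push_cast
        ring
    rw [h2, h3]
    linear_combination -hc k
  have hdF (c : (Fin (m + 1) → ℤ) → ℂ) (hc : RapidDecay c) (i : Fin (m + 1)) :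
      pd i (fun z => (fsum h c z).re) = fun z => (fsum h (D i c) z).re := by
    ext z
    rw [pd_re ((contDiff_fsum h hc).differentiable (by simp) z), fderiv_fsum_single h hc]
  refine ⟨fun z => (fsum h c z).re, Complex.reCLM.contDiff.comp (contDiff_fsum h hcd),
    fun z i => congrArg Complex.re (fsum_add_single hh c z i), fun z => ?_⟩
  have h1 := congrArg Complex.re (hres z)
  simp only [Complex.sub_re, Complex.re_sum, Complex.re_ofReal_mul, Complex.ofReal_re,
    Complex.zero_re] at h1
  simp only [lap, hdF c hcd, hdF _ (hDd _)]
  linarith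

lemma contDiff_pd {N : ℕ} {g : (Fin N → ℝ) → ℝ} (hg : ContDiff ℝ (⊤ : ℕ∞) g) (i : Fin N) :
    ContDiff ℝ (⊤ : ℕ∞) (pd i g) :=
  (hg.fderiv_right (m := (⊤ : ℕ∞)) (by simp)).clm_apply contDiff_const

lemma pd_add_of_periodic {N : ℕ} {g : (Fin N → ℝ) → ℝ} {v : Fin N → ℝ}
    (hg : ∀ z, g (z + v) = g z) (i : Fin N) (z : Fin N → ℝ) : pd i g (z + v) = pd i g z := by
  rw [pd, ← fderiv_comp_add_right, funext hg, pd]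

lemma pd_const_mul_add {N : ℕ} {p q : (Fin N → ℝ) → ℝ} {z : Fin N → ℝ}
    (hp : DifferentiableAt ℝ p z) (hq : DifferentiableAt ℝ q z) (a b : ℝ) (i : Fin N) :
    pd i (fun w => a * p w + b * q w) z = a * pd i p z + b * pd i q z := by
  simp [pd, fderiv_fun_add (hp.const_mul a) (hq.const_mul b), fderiv_const_mul hp,
    fderiv_const_mul hq]

lemma lap_const_mul_add {N : ℕ} {p q : (Fin N → ℝ) → ℝ} (hp : ContDiff ℝ (⊤ : ℕ∞) p)
    (hq : ContDiff ℝ (⊤ : ℕ∞) q) (a b : ℝ) (z : Fin N → ℝ) :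
    lap (fun w => a * p w + b * q w) z = a * lap p z + b * lap q z := by
  have h1 (i : Fin N) : pd i (fun w => a * p w + b * q w)
      = fun w => a * pd i p w + b * pd i q w := funext fun w =>
    pd_const_mul_add (hp.differentiable (by simp) w) (hq.differentiable (by simp) w) a b i
  simp only [lap, h1]
  rw [Finset.mul_sum, Finset.mul_sum, ← Finset.sum_add_distrib]
  exact Finset.sum_congr rfl fun i _ => pd_const_mul_add
    ((contDiff_pd hp i).differentiable (by simp) z)
    ((contDiff_pd hq i).differentiable (by simp) z) a b i

lemma integral_pd_eq_zero {m : ℕ} {h : ℝ} (hh : 0 < h) {g : (Fin (m + 1) → ℝ) → ℝ}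
    (hg : ContDiff ℝ (⊤ : ℕ∞) g) (hp : ∀ z j, g (z + Pi.single j h) = g z) (i : Fin (m + 1)) :
    ∫ z in Icc (0 : Fin (m + 1) → ℝ) (fun _ => h), pd i g z = 0 := by
  have h1 := integral_fderiv_single_eq_zero hh (G := fun z => (g z : ℂ))
    (Complex.ofRealCLM.contDiff.comp (hg.of_le (by exact_mod_cast le_top)))
    (fun z j => by rw [hp]) i
  simp only [fderiv_ofReal_comp (hg.differentiable (by simp) _)] at h1
  rw [integral_complex_ofReal] at h1
  exact_mod_cast h1

/-- An `L`-harmonic map `p` asymptotic to the first coordinate and the corrector `χ` homogenizing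
its energy density, for `L = Δ - u·∇`. -/
theorem exists_energy_corrector {m : ℕ} {h : ℝ} (hh : 0 < h)
    {u : (Fin (m + 1) → ℝ) → Fin (m + 1) → ℝ} (hu : ContDiff ℝ (⊤ : ℕ∞) u)
    (hdiv : ∀ z, ∑ i, pd i (fun w => u w i) z = 0)
    (hp : ∀ z i, u (z + Pi.single i h) = u z)
    (hmean : ∫ z in univ.pi fun _ : Fin (m + 1) => Ico (0:ℝ) h, u z 0 = 0) :
    ∃ (p χ : (Fin (m + 1) → ℝ) → ℝ) (D : ℝ), ContDiff ℝ (⊤ : ℕ∞) p ∧ ContDiff ℝ (⊤ : ℕ∞) χ ∧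
      (∀ z i, p (z + Pi.single i h) - (z + Pi.single i h : Fin (m + 1) → ℝ) 0 = p z - z 0) ∧
      (∀ z i, χ (z + Pi.single i h) = χ z) ∧
      (∀ z i j, pd i p (z + Pi.single j h) = pd i p z) ∧ 1 ≤ D ∧
      (∀ z, lap p z - ∑ i, u z i * pd i p z = 0) ∧
      ∀ z, lap χ z - ∑ i, u z i * pd i χ z = D - ∑ i, pd i p z ^ 2 := by
  obtain ⟨χ, hχ, hχp, hχe⟩ := exists_corrector hh hu hdiv hp (contDiff_pi.1 hu 0)
    (fun z i => by rw [hp]) hmean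
  have he : ContDiff ℝ (⊤ : ℕ∞) fun z : Fin (m + 1) → ℝ => z 0 := contDiff_apply ℝ ℝ 0
  set p : (Fin (m + 1) → ℝ) → ℝ := fun z => 1 * z 0 + 1 * χ z with hpdef
  have hps : ContDiff ℝ (⊤ : ℕ∞) p := (contDiff_const.mul he).add (contDiff_const.mul hχ)
  have hpd (i : Fin (m + 1)) (z : Fin (m + 1) → ℝ) :
      pd i p z = (if i = 0 then 1 else 0) + pd i χ z := by
    rw [hpdef, pd_const_mul_add (he.differentiable (by simp) z) (hχ.differentiable (by simp) z),
      pd_eval, one_mul, one_mul]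
  have hpp (z : Fin (m + 1) → ℝ) (i j : Fin (m + 1)) :
      pd i p (z + Pi.single j h) = pd i p z := by
    rw [hpd, hpd, pd_add_of_periodic fun z => hχp z j]
  set E : (Fin (m + 1) → ℝ) → ℝ := fun z => ∑ i, pd i p z ^ 2 with hE
  have hEs : ContDiff ℝ (⊤ : ℕ∞) E := ContDiff.sum fun i _ => (contDiff_pd hps i).pow 2
  set S : Set (Fin (m + 1) → ℝ) := Icc 0 fun _ => h with hS
  have hint {g : (Fin (m + 1) → ℝ) → ℝ} (hg : Continuous g) : IntegrableOn g S :=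
    hg.continuousOn.integrableOn_compact isCompact_Icc
  set V : ℝ := volume.real S with hV
  have hV0 : 0 < V := by
    rw [hV, hS, volume_real_cell hh]
    positivity
  have hconst (a : ℝ) : ∫ _ in S, a = V * a := by rw [setIntegral_const, smul_eq_mul]
  set D : ℝ := V⁻¹ * ∫ z in S, E z with hD
  have hVD : V * D = ∫ z in S, E z := mul_inv_cancel_left₀ hV0.ne' _
  have hD1 : 1 ≤ D := by
    have h1 : ∫ z in S, (2 * pd 0 χ z + 1) ≤ ∫ z in S, E z := by
      refine setIntegral_mono_on (hint ?_) (hint hEs.continuous) measurableSet_Icc fun z _ => ?_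
      · exact (continuous_const.mul (contDiff_pd hχ 0).continuous).add continuous_const
      · have h2 : pd 0 p z ^ 2 ≤ E z := Finset.single_le_sum (f := fun i => pd i p z ^ 2)
          (fun i _ => sq_nonneg _) (Finset.mem_univ 0)
        rw [hpd, if_pos rfl] at h2
        nlinarith [sq_nonneg (pd 0 χ z)]
    rw [integral_add ((hint (contDiff_pd hχ 0).continuous).const_mul 2) (hint continuous_const),
      integral_const_mul, integral_pd_eq_zero hh hχ hχp, hconst, ← hVD, mul_zero, zero_add] at h1
    exact le_of_mul_le_mul_left h1 hV0
  obtain ⟨χ₂, hχ₂, hχ₂p, hχ₂e⟩ := exists_corrector hh hu hdiv hp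
    (g := fun z => D - E z) (contDiff_const.sub hEs) (fun z i => by simp only [hE, hpp]) (by
      have hae : (univ.pi fun _ => Ico 0 h) =ᵐ[volume] S := Measure.univ_pi_Ico_ae_eq_Icc
      rw [setIntegral_congr_set hae, integral_sub (hint continuous_const) (hint hEs.continuous),
        hconst, hVD, sub_self])
  refine ⟨p, χ₂, D, hps, hχ₂, fun z i => ?_, hχ₂p, hpp, hD1, fun z => ?_, hχ₂e⟩
  · simp only [hpdef, hχp]
    ring
  · have h1 := hχe z
    rw [hpdef, lap_const_mul_add he hχ, lap_eval]
    simp only [← hpdef, hpd, mul_add, Finset.sum_add_distrib, mul_ite, mul_one, mul_zero,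
      Finset.sum_ite_eq', Finset.mem_univ, if_true]
    linarith

/-- Solutions that are large on a sufficiently long interval spread at a positive speed. -/
theorem exists_spreading_speed {m : ℕ} {h M : ℝ} (hh : 0 < h) (hM : 0 < M)
    {u : (Fin (m + 1) → ℝ) → Fin (m + 1) → ℝ} (hu : ContDiff ℝ (⊤ : ℕ∞) u)
    (hdiv : ∀ z, ∑ i, pd i (fun w => u w i) z = 0)
    (hp : ∀ z i, u (z + Pi.single i h) = u z)
    (hmean : ∫ z in univ.pi fun _ : Fin (m + 1) => Ico (0:ℝ) h, u z 0 = 0)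
    {f : ℝ → ℝ} {K : NNReal} (hf : LipschitzOnWith K f (Icc 0 1)) (hf0 : f 0 = 0)
    (hf_pos : ∀ s ∈ Ioo (0:ℝ) 1, 0 < f s) :
    ∃ γ L : ℝ, 0 < γ ∧ 0 < L ∧ ∀ T0 T, IsCylSol m h M u f T0 T → ∀ t₀ : ℝ, 0 ≤ t₀ →
      (∀ z, |z 0| ≤ L → 1 / 2 ≤ T t₀ z) →
      ∀ t z, t₀ ≤ t → |z 0| ≤ γ * (t - t₀) → 3 / 8 ≤ T t z := by
  obtain ⟨κ, hκ, hfκ⟩ := exists_pos_le_of_Icc_subset hf.continuousOn hf_pos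
    (a := 1 / 8) (b := 3 / 8) (by norm_num) (by norm_num) (by norm_num)
  obtain ⟨p, χ, D, hps, hχs, hpp, hχp, hpdp, hD, hpe, hχe⟩ :=
    exists_energy_corrector hh hu hdiv hp hmean
  have hEc : Continuous fun z => ∑ i, pd i p z ^ 2 :=
    continuous_finsetSum _ fun i _ => (contDiff_pd hps i).continuous.pow 2
  have hXc : Continuous fun z => ∑ i, pd i χ z ^ 2 :=
    continuous_finsetSum _ fun i _ => (contDiff_pd hχs i).continuous.pow 2
  obtain ⟨C₁, hC₁, hpC⟩ := exists_bound_of_periodic hh (F := fun z => p z - z 0)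
    (hps.continuous.sub (continuous_apply 0)) hpp
  obtain ⟨C₂, hC₂, hχC⟩ := exists_bound_of_periodic hh hχs.continuous hχp
  obtain ⟨C₃, hC₃, hEC⟩ := exists_bound_of_periodic hh hEc fun z j => by simp only [hpdp]
  obtain ⟨C₄, hC₄, hXC⟩ := exists_bound_of_periodic hh hXc fun z j => by
    simp only [pd_add_of_periodic fun z => hχp z j]
  set A := C₃ + C₄ + 1 with hA
  have hA0 : 0 < A := by positivity
  set lam := min 1 (min (1 / (2 * A)) (2 * (M * κ) / (9 * A))) with hlam
  have hl0 : 0 < lam := by positivity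
  have hl1 : lam ≤ 1 := min_le_left _ _
  have hl2 : lam * A ≤ 1 / 2 := by
    have := (min_le_right _ _).trans (min_le_left _ _) |> hlam.le.trans
    rw [le_div_iff₀ (by positivity)] at this
    linarith
  have hl3 : 9 / 2 * (lam * A) ≤ M * κ := by
    have := (min_le_right _ _).trans (min_le_right _ _) |> hlam.le.trans
    rw [le_div_iff₀ (by positivity)] at this
    linarith
  have key (a : ℝ) (ha : |a| = lam) :
      let Q := fun z => a * p z + lam ^ 2 * χ z
      ContDiff ℝ 2 Q ∧ (∀ z, ∀ j : Fin m, Q (z + Pi.single j.succ h) = Q z) ∧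
        (∀ z, |Q z - a * z 0| ≤ C₁ + C₂) ∧
        (∀ z, lam ^ 2 / 2 ≤ lap Q z + ∑ i, pd i Q z ^ 2 - ∑ i, u z i * pd i Q z) ∧
        ∀ z, 9 / 4 * ∑ i, pd i Q z ^ 2 ≤ M * κ := by
    intro Q
    have ha2 : a ^ 2 = lam ^ 2 := by rw [← ha, sq_abs]
    have hQs : ContDiff ℝ (⊤ : ℕ∞) Q :=
      (contDiff_const.mul hps).add (contDiff_const.mul hχs)
    have hpd (i : Fin (m + 1)) (z : Fin (m + 1) → ℝ) :
        pd i Q z = a * pd i p z + lam ^ 2 * pd i χ z :=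
      pd_const_mul_add (hps.differentiable (by simp) z) (hχs.differentiable (by simp) z) a _ i
    have hsq (z : Fin (m + 1) → ℝ) : ∑ i, pd i Q z ^ 2 = lam ^ 2 * ∑ i, pd i p z ^ 2
        + 2 * (a * lam ^ 2) * ∑ i, pd i p z * pd i χ z + lam ^ 4 * ∑ i, pd i χ z ^ 2 := by
      simp only [Finset.mul_sum, ← Finset.sum_add_distrib, hpd]
      refine Finset.sum_congr rfl fun i _ => ?_
      rw [← ha2]
      linear_combination pd i χ z ^ 2 * (a ^ 2 + lam ^ 2) * ha2
    have hE (z : Fin (m + 1) → ℝ) := (le_abs_self _).trans (hEC z)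
    have hX (z : Fin (m + 1) → ℝ) := (le_abs_self _).trans (hXC z)
    have hX0 (z : Fin (m + 1) → ℝ) : 0 ≤ ∑ i, pd i χ z ^ 2 :=
      Finset.sum_nonneg fun i _ => sq_nonneg _
    have hP (z : Fin (m + 1) → ℝ) : |∑ i, pd i p z * pd i χ z| ≤ A / 2 := by
      have h1 : |∑ i, pd i p z * pd i χ z|
          ≤ ∑ i, (pd i p z ^ 2 / 2 + pd i χ z ^ 2 / 2) := by
        refine (Finset.abs_sum_le_sum_abs _ _).trans (Finset.sum_le_sum fun i _ => ?_)
        rw [abs_mul, ← sq_abs (pd i p z), ← sq_abs (pd i χ z)]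
        nlinarith [sq_nonneg (|pd i p z| - |pd i χ z|)]
      rw [Finset.sum_add_distrib, ← Finset.sum_div, ← Finset.sum_div] at h1
      linarith [hE z, hX z]
    have hcross (z : Fin (m + 1) → ℝ) :
        |2 * (a * lam ^ 2) * ∑ i, pd i p z * pd i χ z| ≤ lam ^ 3 * A := by
      rw [abs_mul, abs_mul, abs_mul, ha, abs_two, abs_of_nonneg (sq_nonneg lam)]
      calc 2 * (lam * lam ^ 2) * |∑ i, pd i p z * pd i χ z|
          ≤ 2 * (lam * lam ^ 2) * (A / 2) := by
            gcongr
            exact hP z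
        _ = _ := by ring
    refine ⟨contDiff_infty.1 hQs 2, fun z j => ?_, fun z => ?_, fun z => ?_,
      fun z => ?_⟩
    · have h1 := hpp z j.succ
      have h2 : (Pi.single j.succ h : Fin (m + 1) → ℝ) 0 = 0 := by simp
      rw [Pi.add_apply, h2, add_zero, sub_left_inj] at h1
      simp only [Q, h1, hχp]
    · have h1 : Q z - a * z 0 = a * (p z - z 0) + lam ^ 2 * χ z := by
        simp only [Q]
        ring
      rw [h1]
      refine (abs_add_le _ _).trans ?_
      rw [abs_mul, abs_mul, ha, abs_of_nonneg (sq_nonneg lam)]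
      have h2 := hpC z
      have h3 := hχC z
      rw [Real.norm_eq_abs] at h2 h3
      refine add_le_add ?_ ?_
      · exact (mul_le_of_le_one_left (abs_nonneg _) hl1).trans h2
      · exact (mul_le_of_le_one_left (abs_nonneg _) (pow_le_one₀ hl0.le hl1)).trans h3
    · have h1 : ∑ i, u z i * pd i Q z
          = a * ∑ i, u z i * pd i p z + lam ^ 2 * ∑ i, u z i * pd i χ z := by
        simp only [Finset.mul_sum, ← Finset.sum_add_distrib, hpd]
        exact Finset.sum_congr rfl fun i _ => by ring
      have h2 : lap Q z = a * lap p z + lam ^ 2 * lap χ z := lap_const_mul_add hps hχs a _ z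
      have h3 : lam ^ 2 / 2 ≤ lam ^ 2 * D + 2 * (a * lam ^ 2) * ∑ i, pd i p z * pd i χ z
          + lam ^ 4 * ∑ i, pd i χ z ^ 2 := by
        have h4 := (abs_le.1 (hcross z)).1
        have h5 := mul_le_mul_of_nonneg_left hl2 (sq_nonneg lam)
        have h6 := mul_le_mul_of_nonneg_left hD (sq_nonneg lam)
        have h7 := mul_nonneg (pow_nonneg hl0.le 4) (hX0 z)
        linarith
      rw [h1, h2, hsq]
      linear_combination h3 - a * hpe z - lam ^ 2 * hχe z
    · rw [hsq]
      have h1 := (abs_le.1 (hcross z)).2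
      have h2 := mul_le_mul_of_nonneg_left (hE z) (sq_nonneg lam)
      have h3 := mul_le_mul_of_nonneg_left (hX z) (pow_nonneg hl0.le 4)
      have h4 : lam ^ 4 * C₄ ≤ lam ^ 2 * C₄ :=
        mul_le_mul_of_nonneg_right (pow_le_pow_of_le_one hl0.le hl1 (by norm_num)) hC₄
      have h5 : lam ^ 3 * A ≤ lam ^ 2 * A :=
        mul_le_mul_of_nonneg_right (pow_le_pow_of_le_one hl0.le hl1 (by norm_num)) hA0.le
      have h6 : lam ^ 2 * A ≤ lam * A :=
        mul_le_mul_of_nonneg_right (pow_le_of_le_one hl0.le hl1 two_ne_zero) hA0.le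
      have h7 : lam ^ 2 * A = lam ^ 2 * C₃ + lam ^ 2 * C₄ + lam ^ 2 := by rw [hA]; ring
      nlinarith [sq_nonneg lam]
  obtain ⟨k1, k2, k3, k4, k5⟩ := key (-lam) (by rw [abs_neg, abs_of_pos hl0])
  obtain ⟨l1, l2, l3, l4, l5⟩ := key lam (abs_of_pos hl0)
  obtain ⟨L, hL, hspread⟩ := exists_linear_spreading hh hM hf (fun s hs => by
    rcases hs.1.eq_or_lt with rfl | h1
    · exact hf0.ge
    · exact (hf_pos s ⟨h1, hs.2⟩).le) hfκ k1 l1 k2 l2 (c := lam ^ 2 / 2) (μ := lam)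
      (by positivity) hl0 (add_nonneg hC₁ hC₂)
      (fun z => by simpa only [neg_mul, sub_neg_eq_add] using k3 z) l3 k4 l4 k5 l5
  exact ⟨lam ^ 2 / 2 / lam, L, by positivity, hL, hspread⟩

end

/-- For a smooth, divergence-free, `h`-periodic, mean-zero flow `u` and
a Lipschitz combustion nonlinearity `f` (positive on `(0,1)`, vanishing at `0` and `1`),
there are `0 < γ₁ < γ₂ < ∞` (independent of `η`) so that for every `η > 0` there is `L₁(η)`
such that every classical solution whose initial datum is compactly supported in `x`,
takes values in `[0,1]`, and is `≥ η` for `|x| ≤ L₁`, spreads with speed at least `γ₁`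
and at most `γ₂`. -/
theorem quenching_paper_stmt0
    (m : ℕ) (hm : 1 ≤ m) (h M : ℝ) (hh : 0 < h) (hM : 0 < M)
    (u : (Fin (m+1) → ℝ) → Fin (m+1) → ℝ)
    (hu_smooth : ContDiff ℝ (⊤ : ℕ∞) u)
    (hu_div : ∀ z, ∑ i, pd i (fun w => u w i) z = 0)
    (hu_per : ∀ z (i : Fin (m+1)), u (z + Pi.single i h) = u z)
    (hu_mean : ∀ i, ∫ z in Set.univ.pi fun _ : Fin (m+1) => Set.Ico (0:ℝ) h, u z i = 0)
    (f : ℝ → ℝ) (hf_lip : ∃ K, LipschitzOnWith K f (Set.Icc 0 1))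
    (hf0 : f 0 = 0) (hf1 : f 1 = 0) (hf_pos : ∀ s ∈ Set.Ioo (0:ℝ) 1, 0 < f s) :
    ∃ γ₁ γ₂ : ℝ, 0 < γ₁ ∧ γ₁ < γ₂ ∧
      ∀ η : ℝ, 0 < η → ∃ L₁ : ℝ, 0 < L₁ ∧
        ∀ (T0 : (Fin (m+1) → ℝ) → ℝ) (T : ℝ → (Fin (m+1) → ℝ) → ℝ),
          IsCylSol m h M u f T0 T →
          (∀ z, T0 z ∈ Set.Icc (0:ℝ) 1) →
          (∃ L : ℝ, ∀ z, L ≤ |z 0| → T0 z = 0) →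
          (∀ z, |z 0| ≤ L₁ → η ≤ T0 z) →
          ((∀ ε > (0:ℝ), ∃ t₀ : ℝ, ∀ t ≥ t₀, ∀ z, |z 0| ≤ γ₁ * t → 1 - ε ≤ T t z) ∧
           (∀ ε > (0:ℝ), ∃ t₀ : ℝ, ∀ t ≥ t₀, ∀ z, γ₂ * t ≤ |z 0| → T t z ≤ ε)) := by
  obtain ⟨K, hf⟩ := hf_lip
  obtain ⟨U, hU, huU⟩ := exists_bound_of_periodic hh hu_smooth.continuous hu_per
  have hu0 (z : Fin (m + 1) → ℝ) : |u z 0| ≤ U := (norm_le_pi_norm (u z) 0).trans (huU z)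
  have hMK : 0 ≤ M * (K : ℝ) := mul_nonneg hM.le K.2
  obtain ⟨γ, L, hγ, hL, hspread⟩ := exists_spreading_speed hh hM hu_smooth hu_div hu_per
    (hu_mean 0) hf hf0 hf_pos
  have hC (z : Fin (m + 1) → ℝ) : 1 + |u z 0| ≤ 1 + U := by linarith [hu0 z]
  refine ⟨γ / 2, 1 + U + M * K + γ + 1, half_pos hγ, by linarith, fun η hη => ?_⟩
  obtain ⟨R, τ, hR, hτ, hign⟩ := exists_ignition hh hM hf hf0 hf_pos hC
    (η := min η (1 / 2)) (ε := 1 / 2) (by positivity) (min_le_right _ _) (by norm_num) le_rfl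
  refine ⟨L + R, by positivity, fun T0 T hT _ ⟨L₀, hL₀⟩ hT0 => ⟨fun ε hε => ?_, fun ε hε => ?_⟩⟩
  · have hhalf (z : Fin (m + 1) → ℝ) (hz : |z 0| ≤ L) : 1 / 2 ≤ T τ z := by
      have h1 := hign T0 T hT 0 (z 0) le_rfl (fun w hw => ?_) z rfl
      · rw [zero_add] at h1
        linarith
      · rw [hT.init]
        refine (min_le_left _ _).trans (hT0 w ?_)
        have := abs_add_le (w 0 - z 0) (z 0)
        rw [sub_add_cancel] at this
        linarith
    have hlin := hspread T0 T hT τ hτ.le hhalf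
    obtain ⟨R', τ', hR', hτ', hign'⟩ := exists_ignition hh hM hf hf0 hf_pos hC
      (η := 3 / 8) (ε := min ε (1 / 2)) (by norm_num) (by norm_num) (by positivity)
      (min_le_right _ _)
    have hg : γ / 2 * (2 * (τ + τ') + 2 * R' / γ) = γ * (τ + τ') + R' := by
      field_simp
    refine ⟨2 * (τ + τ') + 2 * R' / γ, fun t ht z hz => ?_⟩
    have h0 : 0 < 2 * R' / γ := by positivity
    have h1 := hign' T0 T hT (t - τ') (z 0) (by linarith) (fun w hw => ?_) z rfl
    · rw [sub_add_cancel] at h1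
      linarith [min_le_left ε (1 / 2)]
    · refine hlin (t - τ') w (by linarith) ?_
      have h2 := abs_add_le (w 0 - z 0) (z 0)
      rw [sub_add_cancel] at h2
      have h3 := mul_le_mul_of_nonneg_left ht (half_pos hγ).le
      rw [hg] at h3
      linarith
  · refine ⟨max 0 (L₀ - Real.log ε), fun t ht z hz => ?_⟩
    have ht0 : 0 ≤ t := (le_max_left _ _).trans ht
    refine (hT.le_exp hh hM hf hf0 (C := 1 + U + M * K) (L := L₀)
      (fun z => by linarith [hu0 z]) hL₀ ht0 z).trans ?_
    rw [← Real.le_log_iff_exp_le hε]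
    have h1 := (le_max_right _ _).trans ht
    have h2 := mul_nonneg hγ.le ht0
    linarith
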